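/- arXiv:cs/0309014 — 2 statements merged into one kernel-verified Lean document; each statement's English description precedes it below -/
import Mathlib

section
/- For every tour of a region P with t turns there exists a tour of P with at most t turns in which every pixel of P appears at most twice in horizontal passes and at most twice in vertical passes, hence at most 4 times in total; in particular the length (number of unit moves) of this tour is at most 4·|P|, and hence at most 4 times the minimum length of a tour of P. -/
/-- A pixel is a point of `ℤ × ℤ`. -/
abbrev Pixel : Type := ℤ × ℤ

/-- Two pixels are adjacent if their ℓ¹-distance is 1. -/
def Adjacent (p q : Pixel) : Prop := |p.1 - q.1| + |p.2 - q.2| = 1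

/-- A cycle: a cyclic sequence of `k ≥ 2` pixels (encoded as a `k`-periodic
function on `ℤ`) in which consecutive pixels are adjacent. -/
structure GridCycle where
  k : ℕ
  two_le : 2 ≤ k
  pts : ℤ → Pixel
  periodic : ∀ i : ℤ, pts (i + k) = pts i
  adj : ∀ i : ℤ, Adjacent (pts i) (pts (i + 1))

/-- The set of pixels covered by a cycle. -/
def GridCycle.covers (C : GridCycle) : Set Pixel := Set.range C.pts

/-- Turn cost at position `i`: 0 if the walk goes straight, 2 for a U-turn,
1 for a 90° turn. -/
def GridCycle.turnCost (C : GridCycle) (i : ℤ) : ℕ :=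
  if C.pts (i + 1) - C.pts i = C.pts i - C.pts (i - 1) then 0
  else if C.pts (i + 1) - C.pts i = -(C.pts i - C.pts (i - 1)) then 2
  else 1

/-- The number of turns of a cycle: total turn cost over all positions. -/
def GridCycle.turns (C : GridCycle) : ℕ :=
  ∑ i ∈ Finset.range C.k, C.turnCost (i : ℤ)

/-- A set of pixels is connected under adjacency. -/
def ConnectedIn (P : Set Pixel) : Prop :=
  ∀ p ∈ P, ∀ q ∈ P, Relation.ReflTransGen (fun a b => b ∈ P ∧ Adjacent a b) p q

/-- A region is a finite nonempty set of pixels connected under adjacency. -/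
def IsRegion (P : Set Pixel) : Prop := P.Finite ∧ P.Nonempty ∧ ConnectedIn P

/-- A tour of `P`: a cycle whose pixels lie in `P` covering every pixel of `P`. -/
def IsTour (P : Set Pixel) (C : GridCycle) : Prop := C.covers = P

/-- A cycle cover of `P`: a finite collection of cycles with pixels in `P`
covering every pixel of `P`. -/
def IsCycleCover (P : Set Pixel) (CC : List GridCycle) : Prop :=
  (∀ C ∈ CC, C.covers ⊆ P) ∧ ∀ p ∈ P, ∃ C ∈ CC, p ∈ C.covers

/-- The number of turns of a cycle cover. -/
def coverTurns (CC : List GridCycle) : ℕ := (CC.map GridCycle.turns).sum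

/-- A horizontal strip of `P`: a maximal horizontal run of pixels of `P`. -/
def IsHStrip (P S : Set Pixel) : Prop :=
  ∃ x y : ℤ, ∃ ℓ : ℕ, S = {p : Pixel | p.2 = y ∧ x ≤ p.1 ∧ p.1 ≤ x + (ℓ : ℤ)} ∧
    S ⊆ P ∧ (x - 1, y) ∉ P ∧ (x + (ℓ : ℤ) + 1, y) ∉ P

/-- A vertical strip of `P`: a maximal vertical run of pixels of `P`. -/
def IsVStrip (P S : Set Pixel) : Prop :=
  ∃ x y : ℤ, ∃ ℓ : ℕ, S = {p : Pixel | p.1 = x ∧ y ≤ p.2 ∧ p.2 ≤ y + (ℓ : ℤ)} ∧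
    S ⊆ P ∧ (x, y - 1) ∉ P ∧ (x, y + (ℓ : ℤ) + 1) ∉ P

/-- A strip of `P` is a horizontal or vertical strip. -/
def IsStrip (P S : Set Pixel) : Prop := IsHStrip P S ∨ IsVStrip P S

/-- A strip cover of `P`: a set of strips of `P` whose union is `P`. -/
def IsStripCover (P : Set Pixel) (F : Set (Set Pixel)) : Prop :=
  (∀ S ∈ F, IsStrip P S) ∧ ⋃₀ F = P

/-- The minimum size of a strip cover of `P`. -/
noncomputable def minStripCover (P : Set Pixel) : ℕ :=
  sInf {m | ∃ F, IsStripCover P F ∧ F.ncard = m}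

/-- A rook placement in `P`: a subset of `P` no two distinct elements of which
lie in a common strip of `P`. -/
def IsRookPlacement (P R : Set Pixel) : Prop :=
  R ⊆ P ∧ ∀ p ∈ R, ∀ q ∈ R, p ≠ q → ¬∃ S, IsStrip P S ∧ p ∈ S ∧ q ∈ S

/-- A maximal rook placement: every pixel of `P` lies in a common strip with
some element of `R`. -/
def IsMaximalRookPlacement (P R : Set Pixel) : Prop :=
  IsRookPlacement P R ∧ ∀ p ∈ P, ∃ r ∈ R, ∃ S, IsStrip P S ∧ p ∈ S ∧ r ∈ S


/-- A pass of a walk through a pixel: the pixel together with the unordered pair of its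
neighbours on the walk. -/
def gridPass (p x y : Pixel) : Pixel × Multiset Pixel := (p, {x, y})

theorem gridPass_comm (p x y : Pixel) : gridPass p x y = gridPass p y x := by
  simp only [gridPass, Multiset.pair_comm]

theorem gridPass_inj {p x y q z w : Pixel} (h : gridPass p x y = gridPass q z w) :
    p = q ∧ (x = z ∧ y = w ∨ x = w ∧ y = z) := by
  simp only [gridPass, Prod.mk.injEq, Multiset.insert_eq_cons] at h
  refine ⟨h.1, ?_⟩
  have h2 := h.2
  rw [Multiset.cons_eq_cons] at h2
  rcases h2 with ⟨h2, h3⟩ | ⟨_, cs, h3, h4⟩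
  · left; exact ⟨h2, by simpa using h3⟩
  · right
    have h5 := congrArg Multiset.card h3
    have h6 : cs = 0 := by simpa using h5
    subst h6
    simp only [Multiset.cons_zero, Multiset.singleton_inj] at h3 h4
    exact ⟨h4.symm, h3⟩

/-- The number of turns in a pass. -/
def passCost (q : Pixel × Multiset Pixel) : ℕ :=
  if q.2.sum = q.1 + q.1 then 0 else if q.2.Nodup then 1 else 2

theorem passCost_pass (p x y : Pixel) :
    passCost (gridPass p x y) = if x + y = p + p then 0 else if x = y then 2 else 1 := by
  by_cases h : x = y <;> simp [passCost, gridPass, h]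

theorem passCost_le_two (q : Pixel × Multiset Pixel) : passCost q ≤ 2 := by
  unfold passCost; split_ifs <;> omega

theorem add_self_eq_add_self_iff {p q : Pixel} : p + p = q + q ↔ p = q := by
  simp only [Prod.ext_iff, Prod.fst_add, Prod.snd_add]
  omega

theorem passCost_pass_self {p x : Pixel} (h : x ≠ p) : passCost (gridPass p x x) = 2 := by
  simp [passCost_pass, add_self_eq_add_self_iff, h]

theorem passCost_straight {p x y : Pixel} (h : x + y = p + p) : passCost (gridPass p x y) = 0 := by
  simp [passCost_pass, h]

theorem passCost_turn {p x y : Pixel} (h : x + y ≠ p + p) (h' : x ≠ y) :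
    passCost (gridPass p x y) = 1 := by
  simp [passCost_pass, h, h']

theorem passCost_le_one {p x y : Pixel} (h' : x ≠ y) :
    passCost (gridPass p x y) ≤ 1 := by
  rw [passCost_pass]; split_ifs <;> omega

/-- The triangle inequality for turn costs at `p`; it fails only if both passes on the
right are straight. -/
theorem passCost_triangle {p x y b : Pixel}
    (h : ¬(x = y ∧ x + b = p + p)) :
    passCost (gridPass p x y) ≤ passCost (gridPass p x b) + passCost (gridPass p b y) := by
  by_cases hxy : x = y
  · subst hxy
    have h1 : x + b ≠ p + p := fun h' => h ⟨rfl, h'⟩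
    have h2 : b + x ≠ p + p := by rwa [add_comm]
    have := passCost_le_two (gridPass p x x)
    rw [passCost_pass p x b, passCost_pass p b x, if_neg h1, if_neg h2]
    split_ifs <;> omega
  · have h1 := passCost_le_one (p := p) hxy
    by_cases hxb : x + b = p + p
    · have h2 : b + y ≠ p + p := by
        intro h2
        rw [← hxb, add_comm x b] at h2
        exact hxy (add_left_cancel h2).symm
      rw [passCost_pass p b y, if_neg h2]
      split_ifs <;> omega
    · rw [passCost_pass p x b, if_neg hxb]
      split_ifs <;> omega

theorem Adjacent.ne {p q : Pixel} (h : Adjacent p q) : p ≠ q := by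
  rintro rfl
  simp [Adjacent] at h

theorem Adjacent.symm {p q : Pixel} (h : Adjacent p q) : Adjacent q p := by
  unfold Adjacent at *
  rwa [abs_sub_comm q.1, abs_sub_comm q.2]

theorem Multiset.map_range_succ_of_periodic {α : Type*} (k : ℕ) (g : ℤ → α)
    (hg : ∀ i, g (i + k) = g i) :
    (Multiset.range k).map (fun i : ℕ => g (i + 1)) = (Multiset.range k).map (fun i : ℕ => g i) := by
  have h1 := Finset.sum_range_succ (fun i : ℕ => ({g i} : Multiset α)) k
  have h2 := Finset.sum_range_succ' (fun i : ℕ => ({g i} : Multiset α)) k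
  rw [h1] at h2
  have h3 : g (k : ℤ) = g 0 := by simpa using hg 0
  simp only [h3, Nat.cast_zero, Nat.cast_add, Nat.cast_one] at h2
  have h4 := add_right_cancel h2
  rw [← Multiset.sum_map_singleton ((Multiset.range k).map (fun i : ℕ => g (i + 1))),
    ← Multiset.sum_map_singleton ((Multiset.range k).map (fun i : ℕ => g i)),
    Multiset.map_map, Multiset.map_map]
  exact h4.symm

theorem Multiset.map_range_add_of_periodic {α : Type*} (k : ℕ) (g : ℤ → α)
    (hg : ∀ i, g (i + k) = g i) (c : ℕ) :
    (Multiset.range k).map (fun i : ℕ => g (i + c)) = (Multiset.range k).map (fun i : ℕ => g i) := by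
  induction c with
  | zero => simp
  | succ c ih =>
    rw [← ih]
    have := Multiset.map_range_succ_of_periodic k (fun i => g (i + c)) (fun i => by
      rw [← hg (i + c)]; congr 1; ring)
    rw [← this]
    congr 1; funext i; congr 1; push_cast; ring

theorem Multiset.map_range_reflect {α : Type*} (n : ℕ) (g : ℕ → α) :
    (Multiset.range n).map (fun i => g (n - 1 - i)) = (Multiset.range n).map g := by
  have h := Finset.sum_range_reflect (fun i => ({g i} : Multiset α)) n
  rw [← Multiset.sum_map_singleton ((Multiset.range n).map (fun i => g (n - 1 - i))),
    ← Multiset.sum_map_singleton ((Multiset.range n).map g), Multiset.map_map, Multiset.map_map]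
  exact h

theorem Multiset.exists_cons_of_cons_eq_cons {α : Type*} {a b : α} {s t : Multiset α}
    (h : a ::ₘ s = b ::ₘ t) (hab : a ≠ b) : ∃ u, s = b ::ₘ u ∧ t = a ::ₘ u := by
  rcases Multiset.cons_eq_cons.1 h with ⟨h1, -⟩ | ⟨-, h1⟩
  · exact absurd h1 hab
  · exact h1

namespace GridCycle

/-- The pass of a cycle at position `i`. -/
def passAt (C : GridCycle) (i : ℤ) : Pixel × Multiset Pixel :=
  gridPass (C.pts i) (C.pts (i - 1)) (C.pts (i + 1))

/-- The multiset of all passes of a cycle. -/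
def passes (C : GridCycle) : Multiset (Pixel × Multiset Pixel) :=
  (Multiset.range C.k).map (fun i : ℕ => C.passAt i)

theorem card_passes (C : GridCycle) : C.passes.card = C.k := by simp [passes]

theorem passAt_periodic (C : GridCycle) (i : ℤ) : C.passAt (i + C.k) = C.passAt i := by
  have h1 : i + C.k - 1 = i - 1 + C.k := by ring
  have h2 : i + C.k + 1 = i + 1 + C.k := by ring
  simp only [passAt, h1, h2, C.periodic]

theorem exists_passAt_eq (C : GridCycle) (i : ℤ) :
    ∃ j : ℕ, j < C.k ∧ C.passAt j = C.passAt i := by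
  have hk : (0 : ℤ) < C.k := by have := C.two_le; omega
  refine ⟨(i % C.k).toNat, ?_, ?_⟩
  · have := Int.emod_lt_of_pos i hk
    have := Int.emod_nonneg i hk.ne'
    omega
  · rw [Int.toNat_of_nonneg (Int.emod_nonneg i hk.ne')]
    have h : Function.Periodic C.passAt (C.k : ℤ) := C.passAt_periodic
    rw [Int.emod_def, mul_comm]
    exact h.sub_int_mul_eq (i / C.k)

theorem passAt_mem_passes (C : GridCycle) (i : ℤ) : C.passAt i ∈ C.passes := by
  obtain ⟨j, hj, h⟩ := C.exists_passAt_eq i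
  rw [← h]
  exact Multiset.mem_map_of_mem _ (Multiset.mem_range.2 hj)

theorem exists_of_mem_passes {C : GridCycle} {q} (h : q ∈ C.passes) :
    ∃ i : ℕ, i < C.k ∧ C.passAt i = q := by
  simpa [passes] using h

theorem mem_covers_iff (C : GridCycle) (p : Pixel) :
    p ∈ C.covers ↔ ∃ q ∈ C.passes, q.1 = p := by
  constructor
  · rintro ⟨i, rfl⟩
    exact ⟨_, C.passAt_mem_passes i, rfl⟩
  · rintro ⟨q, hq, rfl⟩
    obtain ⟨i, _, rfl⟩ := exists_of_mem_passes hq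
    exact ⟨i, rfl⟩

theorem turnCost_eq (C : GridCycle) (i : ℤ) : C.turnCost i = passCost (C.passAt i) := by
  rw [passAt, passCost_pass, turnCost]
  congr 1
  · simp only [Prod.ext_iff, Prod.fst_add, Prod.snd_add, Prod.fst_sub, Prod.snd_sub]
    apply propext; constructor <;> rintro ⟨h1, h2⟩ <;> constructor <;> omega
  · congr 1
    simp only [Prod.ext_iff, Prod.fst_neg, Prod.snd_neg, Prod.fst_sub, Prod.snd_sub]
    apply propext; constructor <;> rintro ⟨h1, h2⟩ <;> constructor <;> omega

theorem turns_eq (C : GridCycle) : C.turns = (C.passes.map passCost).sum := by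
  simp only [turns, turnCost_eq, passes, Multiset.map_map]
  rfl

theorem ne_of_pass_mem {C : GridCycle} {p x y : Pixel} (h : gridPass p x y ∈ C.passes) :
    x ≠ p ∧ y ≠ p := by
  obtain ⟨i, _, hi⟩ := exists_of_mem_passes h
  have h1 := (C.adj (i - 1)).ne
  have h2 := (C.adj i).ne
  rw [sub_add_cancel] at h1
  obtain ⟨h3, ⟨h4, h5⟩ | ⟨h4, h5⟩⟩ := gridPass_inj hi <;> subst h3 h4 h5
  · exact ⟨h1, h2.symm⟩
  · exact ⟨h2.symm, h1⟩

theorem exists_eq_pass {C : GridCycle} {q} (h : q ∈ C.passes) : ∃ x y, q = gridPass q.1 x y := by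
  obtain ⟨i, _, rfl⟩ := exists_of_mem_passes h
  exact ⟨_, _, rfl⟩

/-- If a walk passes from `a` to `l`, then it also has a pass at `l` that uses `a`. -/
theorem exists_adjacent_pass {C : GridCycle} {a r l : Pixel} (h : gridPass a r l ∈ C.passes) :
    ∃ w, gridPass l a w ∈ C.passes := by
  obtain ⟨i, _, hi⟩ := exists_of_mem_passes h
  obtain ⟨h3, ⟨h4, h5⟩ | ⟨h4, h5⟩⟩ := gridPass_inj hi <;> subst h3 h4 h5
  · refine ⟨C.pts (i + 1 + 1), ?_⟩
    have := C.passAt_mem_passes (i + 1)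
    rwa [passAt, add_sub_cancel_right] at this
  · refine ⟨C.pts (i - 1 - 1), ?_⟩
    have := C.passAt_mem_passes (i - 1)
    rwa [passAt, sub_add_cancel, gridPass_comm] at this

theorem passes_eq_cons (C : GridCycle) :
    C.passes = gridPass (C.pts 0) (C.pts (C.k - 1)) (C.pts 1) ::ₘ
      (Multiset.range (C.k - 1)).map
        (fun i : ℕ => gridPass (C.pts (i + 1)) (C.pts i) (C.pts (i + 2))) := by
  obtain ⟨n, hn⟩ : ∃ n, C.k = n + 1 := ⟨C.k - 1, by have := C.two_le; omega⟩
  have h0 : C.passAt (C.k : ℤ) = gridPass (C.pts 0) (C.pts (C.k - 1)) (C.pts 1) := by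
    have h1 : C.pts (C.k : ℤ) = C.pts 0 := by simpa using C.periodic 0
    have h2 : C.pts (C.k + 1 : ℤ) = C.pts 1 := by rw [add_comm]; exact C.periodic 1
    rw [passAt, h1, h2]
  have h := Multiset.map_range_succ_of_periodic C.k C.passAt C.passAt_periodic
  rw [passes, ← h, ← h0]
  rw [show C.k - 1 = n by omega, hn, Multiset.range_succ, Multiset.map_cons]
  congr 1
  apply Multiset.map_congr rfl
  intro i _
  simp only [passAt, add_sub_cancel_right, add_assoc]
  norm_num

/-- The cyclic shift of a cycle. -/
def shift (C : GridCycle) (c : ℤ) : GridCycle where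
  k := C.k
  two_le := C.two_le
  pts i := C.pts (i + c)
  periodic i := by rw [← C.periodic (i + c)]; congr 1; ring
  adj i := by have := C.adj (i + c); rwa [add_right_comm] at this

theorem passAt_shift (C : GridCycle) (c i : ℤ) : (C.shift c).passAt i = C.passAt (i + c) := by
  simp only [passAt, shift, sub_add_eq_add_sub, add_right_comm]

theorem passes_shift (C : GridCycle) (c : ℕ) : (C.shift c).passes = C.passes := by
  simp only [passes, passAt_shift]
  exact Multiset.map_range_add_of_periodic C.k C.passAt C.passAt_periodic c

/-- The cycle that traverses a closed walk `g 0, …, g k = g 0`. -/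
def ofClosedWalk (k : ℕ) (hk : 2 ≤ k) (g : ℤ → Pixel) (hg : g k = g 0)
    (hadj : ∀ i : ℤ, 0 ≤ i → i < k → Adjacent (g i) (g (i + 1))) : GridCycle where
  k := k
  two_le := hk
  pts i := g (i % k)
  periodic i := by simp
  adj i := by
    have hk0 : (0 : ℤ) < k := by omega
    have h1 := Int.emod_nonneg i hk0.ne'
    have h2 := Int.emod_lt_of_pos i hk0
    have h3 := hadj (i % k) h1 h2
    by_cases h : i % k + 1 = k
    · have : (i + 1) % (k : ℤ) = 0 := by
        rw [Int.add_emod, Int.emod_eq_of_lt (a := 1) (by omega) (by omega), h, Int.emod_self]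
      rw [this, ← hg]
      rwa [h] at h3
    · have : (i + 1) % (k : ℤ) = i % k + 1 := by
        rw [Int.add_emod, Int.emod_eq_of_lt (a := 1) (by omega) (by omega),
          Int.emod_eq_of_lt (by omega) (by omega)]
      rwa [this]

theorem ofClosedWalk_pts {k : ℕ} {hk : 2 ≤ k} {g : ℤ → Pixel} {hg : g k = g 0} {hadj}
    {i : ℤ} (h0 : 0 ≤ i) (h1 : i ≤ k) : (ofClosedWalk k hk g hg hadj).pts i = g i := by
  rcases h1.lt_or_eq with h | rfl
  · simp [ofClosedWalk, Int.emod_eq_of_lt h0 h]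
  · simp [ofClosedWalk, hg]

theorem passes_ofClosedWalk {k : ℕ} {hk : 2 ≤ k} {g : ℤ → Pixel} {hg : g k = g 0} {hadj} :
    (ofClosedWalk k hk g hg hadj).passes = gridPass (g 0) (g (k - 1)) (g 1) ::ₘ
      (Multiset.range (k - 1)).map (fun i : ℕ => gridPass (g (i + 1)) (g i) (g (i + 2))) := by
  have hk' : (ofClosedWalk k hk g hg hadj).k = k := rfl
  rw [passes_eq_cons, hk', ofClosedWalk_pts le_rfl (by omega),
    ofClosedWalk_pts (by omega) (by omega), ofClosedWalk_pts (by omega) (by omega)]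
  congr 1
  apply Multiset.map_congr rfl
  intro i hi
  rw [Multiset.mem_range] at hi
  rw [ofClosedWalk_pts (by omega) (by omega),
    ofClosedWalk_pts (by omega) (by omega), ofClosedWalk_pts (by omega) (by omega)]

theorem exists_twoOpt_zero (C : GridCycle) {m : ℕ} (hm : 0 < m) (hmk : m < C.k)
    (h : C.pts m = C.pts 0) {N : Multiset (Pixel × Multiset Pixel)}
    (hN : C.passes = C.passAt 0 ::ₘ C.passAt m ::ₘ N) :
    ∃ C' : GridCycle, C'.passes = gridPass (C.pts 0) (C.pts (0 - 1)) (C.pts (m - 1)) ::ₘ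
      gridPass (C.pts 0) (C.pts (0 + 1)) (C.pts (m + 1)) ::ₘ N := by
  obtain ⟨a, rfl⟩ : ∃ a, m = a + 1 := ⟨m - 1, by omega⟩
  obtain ⟨r, hr⟩ : ∃ r, C.k = a + 1 + r + 1 := ⟨C.k - (a + 1) - 1, by omega⟩
  have hk0 : C.pts (C.k : ℤ) = C.pts 0 := by simpa using C.periodic 0
  have hkneg : C.pts (0 - 1) = C.pts (C.k - 1) := by
    rw [← C.periodic (0 - 1)]; congr 1
  rw [Nat.cast_add, Nat.cast_one] at h
  let g : ℤ → Pixel := fun n => if n ≤ a + 1 then C.pts n else C.pts (a + 1 + C.k - n)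
  have g1 : ∀ n : ℤ, n ≤ a + 1 → g n = C.pts n := fun n hn => if_pos hn
  have g2 : ∀ n : ℤ, a + 1 ≤ n → g n = C.pts (a + 1 + C.k - n) := by
    intro n hn
    rcases hn.eq_or_lt with rfl | hn
    · rw [g1 _ le_rfl, add_sub_cancel_left, hk0, h]
    · exact if_neg (by omega)
  have hgk : g C.k = g 0 := by
    rw [g2 _ (by omega), g1 _ (by omega), add_sub_cancel_right, h]
  have hadj : ∀ i : ℤ, 0 ≤ i → i < C.k → Adjacent (g i) (g (i + 1)) := by
    intro i _ _
    by_cases hi : i + 1 ≤ a + 1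
    · rw [g1 _ hi, g1 _ (by omega)]
      exact C.adj i
    · rw [g2 i (by omega), g2 (i + 1) (by omega)]
      have := (C.adj (a + 1 + C.k - (i + 1))).symm
      rwa [show (a + 1 + C.k - (i + 1) + 1 : ℤ) = a + 1 + C.k - i by ring] at this
  refine ⟨ofClosedWalk C.k C.two_le g hgk hadj, ?_⟩
  rw [passes_eq_cons] at hN
  rw [passes_ofClosedWalk]
  have hrange : ∀ f : ℕ → Pixel × Multiset Pixel, (Multiset.range (C.k - 1)).map f =
      f a ::ₘ ((Multiset.range a).map f +
        (Multiset.range r).map (fun i => f (a + 1 + i))) := by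
    intro f
    rw [show C.k - 1 = a + 1 + r by omega, Multiset.range_add, Multiset.map_add,
      Multiset.range_succ, Multiset.map_cons, Multiset.cons_add, Multiset.map_map]
    rfl
  rw [hrange] at hN ⊢
  have hm : C.passAt (a + 1 : ℕ) = gridPass (C.pts (a + 1)) (C.pts a) (C.pts (a + 2)) := by
    rw [passAt, Nat.cast_add, Nat.cast_one, add_sub_cancel_right, add_assoc]
    norm_num
  rw [passAt, hkneg, zero_add, hm, Multiset.cons_inj_right, Multiset.cons_inj_right] at hN
  subst hN
  rw [hkneg, zero_add, Nat.cast_add, Nat.cast_one, add_sub_cancel_right,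
    g1 0 (by omega), g1 1 (by omega), g1 (a + 1) le_rfl, g1 a (by omega),
    g2 (C.k - 1) (by omega), g2 (a + 2) (by omega), h,
    show (a + 1 + C.k - (C.k - 1) : ℤ) = a + 1 + 1 by ring,
    show (a + 1 + C.k - (a + 2) : ℤ) = C.k - 1 by ring, Multiset.cons_swap,
    gridPass_comm _ (C.pts (a + 1 + 1)), gridPass_comm _ (C.pts a)]
  congr 3
  · apply Multiset.map_congr rfl
    intro i hi
    rw [Multiset.mem_range] at hi
    rw [g1 _ (by omega), g1 _ (by omega), g1 _ (by omega)]
  · rw [← Multiset.map_range_reflect r]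
    apply Multiset.map_congr rfl
    intro i hi
    rw [Multiset.mem_range] at hi
    rw [g2 _ (by omega), g2 _ (by omega), g2 _ (by omega), gridPass_comm]
    congr 2 <;> omega

theorem exists_twoOpt (C : GridCycle) {i j : ℕ} (hij : i ≠ j) (hi : i < C.k) (hj : j < C.k)
    (h : C.pts i = C.pts j) {N : Multiset (Pixel × Multiset Pixel)}
    (hN : C.passes = C.passAt i ::ₘ C.passAt j ::ₘ N) :
    ∃ C' : GridCycle, C'.passes = gridPass (C.pts i) (C.pts (i - 1)) (C.pts (j - 1)) ::ₘ
      gridPass (C.pts i) (C.pts (i + 1)) (C.pts (j + 1)) ::ₘ N := by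
  wlog hlt : i < j generalizing i j
  · obtain ⟨C', hC'⟩ := this hij.symm hj hi h.symm (by rw [hN, Multiset.cons_swap]) (by omega)
    refine ⟨C', ?_⟩
    rw [hC', h, gridPass_comm _ (C.pts (j - 1)), gridPass_comm _ (C.pts (j + 1))]
  have e : ∀ c : ℤ, (j - i : ℕ) + c + i = j + c := by intro c; omega
  have := (C.shift i).exists_twoOpt_zero (m := j - i) (N := N) (by omega)
    (by simp only [shift]; omega) (by
      simp only [shift]
      rw [show ((j - i : ℕ) + i : ℤ) = j by omega, zero_add, h])
    (by
      rw [passes_shift, hN, passAt_shift, passAt_shift, zero_add,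
        show ((j - i : ℕ) + i : ℤ) = j by omega])
  obtain ⟨C', hC'⟩ := this
  refine ⟨C', ?_⟩
  rw [hC']
  simp only [shift]
  rw [show ((j - i : ℕ) - 1 + i : ℤ) = j - 1 by omega,
    show ((j - i : ℕ) + 1 + i : ℤ) = j + 1 by omega, zero_add, zero_sub, zero_add,
    neg_add_eq_sub, add_comm 1 (i : ℤ)]

theorem exists_positions {C : GridCycle} {q r N} (h : C.passes = q ::ₘ r ::ₘ N) :
    ∃ i j : ℕ, i ≠ j ∧ i < C.k ∧ j < C.k ∧ C.passAt i = q ∧ C.passAt j = r := by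
  obtain ⟨i, hi, hiq, h1⟩ := (Multiset.map_eq_cons _ _ _ _).2 h
  obtain ⟨j, hj, hjr, -⟩ := (Multiset.map_eq_cons _ _ _ _).2 h1
  have hnd := Multiset.nodup_range C.k
  rw [hnd.mem_erase_iff, Multiset.mem_range] at hj
  exact ⟨i, j, fun e => hj.1 e.symm, Multiset.mem_range.1 hi, hj.2, hiq, hjr⟩

theorem exists_passes_eq {C : GridCycle} {i j h : ℕ} (hi : i < C.k) (hj : j < C.k)
    (hh : h < C.k) (hij : i ≠ j) (hih : i ≠ h) (hjh : j ≠ h) :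
    ∃ N, C.passes = C.passAt i ::ₘ C.passAt j ::ₘ C.passAt h ::ₘ N := by
  have h1 : i ∈ Multiset.range C.k := Multiset.mem_range.2 hi
  have h2 : j ∈ (Multiset.range C.k).erase i :=
    (Multiset.mem_erase_of_ne hij.symm).2 (Multiset.mem_range.2 hj)
  have h3 : h ∈ ((Multiset.range C.k).erase i).erase j :=
    (Multiset.mem_erase_of_ne hjh.symm).2
      ((Multiset.mem_erase_of_ne hih.symm).2 (Multiset.mem_range.2 hh))
  rw [passes, ← Multiset.cons_erase h1, ← Multiset.cons_erase h2, ← Multiset.cons_erase h3]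
  exact ⟨_, by simp only [Multiset.map_cons]; rfl⟩

/-- A U-turn can be exchanged with any other pass at the same pixel. -/
theorem exists_exchange_uturn {C : GridCycle} {a l y z : Pixel} {N}
    (h : C.passes = gridPass a l l ::ₘ gridPass a y z ::ₘ N) :
    ∃ C' : GridCycle, C'.passes = gridPass a l y ::ₘ gridPass a l z ::ₘ N := by
  obtain ⟨i, j, hij, hi, hj, h1, h2⟩ := exists_positions h
  obtain ⟨e1, h1'⟩ := gridPass_inj h1
  obtain ⟨e2, h2'⟩ := gridPass_inj h2
  obtain ⟨C', hC'⟩ := C.exists_twoOpt hij hi hj (e1.trans e2.symm) (N := N) (by rw [h1, h2, h])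
  refine ⟨C', ?_⟩
  have hl : C.pts (i - 1) = l ∧ C.pts (i + 1) = l := by tauto
  rw [hC', hl.1, hl.2, e1]
  rcases h2' with ⟨rfl, rfl⟩ | ⟨rfl, rfl⟩
  · rfl
  · rw [Multiset.cons_swap]

/-- A U-turn can be cut off. -/
theorem exists_remove_uturn {C : GridCycle} {a b : Pixel} (hk : 2 < C.k)
    (h : gridPass a b b ∈ C.passes) :
    ∃ x y N, C.passes = gridPass a b b ::ₘ gridPass b x a ::ₘ gridPass b a y ::ₘ N ∧
      ∃ C' : GridCycle, C'.passes = gridPass b x y ::ₘ N := by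
  obtain ⟨i, hi, hiq⟩ := exists_of_mem_passes h
  obtain ⟨D, hDk, hDp, hD⟩ : ∃ D : GridCycle, D.k = C.k ∧ D.passes = C.passes ∧
      D.passAt (D.k - 1) = gridPass a b b := by
    refine ⟨C.shift (i + 1 : ℕ), rfl, C.passes_shift _, ?_⟩
    rw [passAt_shift, ← hiq, ← C.passAt_periodic i]
    congr 1
    simp only [shift]
    push_cast
    ring
  rw [← hDp]
  rw [← hDk] at hk
  clear hiq hDp hDk hi
  obtain ⟨n, hn⟩ : ∃ n, D.k = n + 3 := ⟨D.k - 3, by omega⟩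
  have hn' : (D.k : ℤ) = n + 3 := by omega
  have hDk0 : D.pts (D.k : ℤ) = D.pts 0 := by simpa using D.periodic 0
  have hD' := gridPass_inj hD
  rw [sub_add_cancel, hDk0, show (D.k - 1 - 1 : ℤ) = n + 1 by omega,
    show (D.k - 1 : ℤ) = n + 2 by omega] at hD'
  obtain ⟨ha, hb⟩ : D.pts (n + 2) = a ∧ (D.pts (n + 1) = b ∧ D.pts 0 = b) := by tauto
  have hn1 : n ≠ 0 := by
    rintro rfl
    have := (D.adj 0).ne
    rw [hb.2] at this
    exact this (by simpa using hb.1.symm)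
  refine ⟨D.pts n, D.pts 1, (Multiset.range n).map
    (fun i : ℕ => gridPass (D.pts (i + 1)) (D.pts i) (D.pts (i + 2))), ?_,
    ofClosedWalk (n + 1) (by omega) D.pts (by push_cast; rw [hb.1, hb.2])
      (fun i _ _ => D.adj i), ?_⟩
  · rw [passes_eq_cons, show D.k - 1 = n + 1 + 1 by omega, Multiset.range_succ,
      Multiset.range_succ, Multiset.map_cons, Multiset.map_cons]
    push_cast
    rw [show (D.k - 1 : ℤ) = n + 2 by omega, show (n + 1 + 2 : ℤ) = D.k by omega, hDk0,
      show (n + 1 + 1 : ℤ) = n + 2 by omega, ha, hb.1, hb.2, Multiset.cons_swap,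
      Multiset.cons_swap (gridPass b a _)]
  · rw [passes_ofClosedWalk, hb.2]
    simp

/-- The number of times a step between `a` and `b` is used, counted at the pixel `a`. -/
def useCount (a b : Pixel) (M : Multiset (Pixel × Multiset Pixel)) : ℕ :=
  (M.map (fun q => if q.1 = a then q.2.count b else 0)).sum

theorem useCount_cons (a b : Pixel) (q) (M : Multiset (Pixel × Multiset Pixel)) :
    useCount a b (q ::ₘ M) = (if q.1 = a then q.2.count b else 0) + useCount a b M := by
  simp [useCount]

theorem useCount_pass_cons (a b p x y : Pixel) (M : Multiset (Pixel × Multiset Pixel)) :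
    useCount a b (gridPass p x y ::ₘ M) =
      (if p = a then (if x = b then 1 else 0) + (if y = b then 1 else 0) else 0) +
        useCount a b M := by
  rw [useCount_cons]
  simp only [gridPass, Multiset.insert_eq_cons, Multiset.count_cons, Multiset.count_singleton,
    eq_comm (a := b)]
  congr 2
  exact add_comm _ _

theorem exists_of_useCount_pos {a b : Pixel} {M : Multiset (Pixel × Multiset Pixel)}
    (h : 0 < useCount a b M) : ∃ q ∈ M, q.1 = a ∧ b ∈ q.2 := by
  by_contra! hc
  have : useCount a b M = 0 := by
    rw [useCount, Multiset.sum_eq_zero_iff]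
    intro n hn
    obtain ⟨q, hq, rfl⟩ := Multiset.mem_map.1 hn
    split_ifs with hqa
    · exact Multiset.count_eq_zero_of_notMem (hc q hq hqa)
    · rfl
  omega

theorem useCount_comm (C : GridCycle) (a b : Pixel) :
    useCount a b C.passes = useCount b a C.passes := by
  have key : ∀ a b : Pixel, useCount a b C.passes =
      ((Multiset.range C.k).map (fun i : ℕ =>
        if C.pts i = a ∧ C.pts (i + 1) = b then 1 else 0)).sum +
      ((Multiset.range C.k).map (fun i : ℕ =>
        if C.pts i = b ∧ C.pts (i + 1) = a then 1 else 0)).sum := by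
    intro a b
    have hshift := Multiset.map_range_succ_of_periodic C.k
      (fun i => if C.pts i = a ∧ C.pts (i - 1) = b then 1 else 0) (fun i => by
        rw [← sub_add_eq_add_sub, C.periodic, C.periodic])
    simp only [add_sub_cancel_right] at hshift
    simp only [and_comm (a := C.pts _ = b)]
    rw [hshift, ← Multiset.sum_map_add, useCount, passes, Multiset.map_map]
    congr 1
    apply Multiset.map_congr rfl
    intro i _
    simp only [Function.comp, passAt, gridPass, Multiset.insert_eq_cons, Multiset.count_cons,
      Multiset.count_singleton, eq_comm (a := b)]
    by_cases h : C.pts i = a <;> simp [h]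
  rw [key a b, key b a, add_comm]

theorem covers_congr {C D : GridCycle}
    (h : ∀ p, (∃ q ∈ C.passes, q.1 = p) ↔ ∃ q ∈ D.passes, q.1 = p) : C.covers = D.covers := by
  ext p
  rw [mem_covers_iff, mem_covers_iff, h]

@[simp] theorem gridPass_fst (p x y : Pixel) : (gridPass p x y).1 = p := rfl

theorem two_lt_k {C : GridCycle} {q r N} (h : C.passes = q ::ₘ r ::ₘ N) (hqr : q.1 = r.1) :
    2 < C.k := by
  obtain ⟨i, j, hij, hi, hj, rfl, rfl⟩ := exists_positions h
  by_contra! hk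
  have h0 := (C.adj 0).ne
  have hqr' : C.pts i = C.pts j := hqr
  obtain ⟨rfl, rfl⟩ | ⟨rfl, rfl⟩ : i = 0 ∧ j = 1 ∨ i = 1 ∧ j = 0 := by omega
  · exact h0 (by simpa using hqr')
  · exact h0 (by simpa using hqr'.symm)

theorem gridPass_ne {p q x y z w : Pixel} (h : p ≠ q) : gridPass p x y ≠ gridPass q z w :=
  fun e => h (gridPass_inj e).1

theorem eq_gridPass_of_mem {C : GridCycle} {q} (h : q ∈ C.passes) {b : Pixel} (hb : b ∈ q.2) :
    ∃ w, q = gridPass q.1 b w := by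
  obtain ⟨x, y, hq⟩ := exists_eq_pass h
  rw [hq] at hb
  simp only [gridPass, Multiset.insert_eq_cons, Multiset.mem_cons, Multiset.mem_singleton] at hb
  rcases hb with rfl | rfl
  · exact ⟨y, hq⟩
  · exact ⟨x, hq.trans (gridPass_comm _ _ _)⟩

/-- If a walk makes a U-turn at `a` coming from `l`, and another pass at `a` uses the pixel
opposite to `l`, then two turns can be saved. -/
theorem exists_save_two_turns (n : ℕ) : ∀ (C : GridCycle) (a l r w : Pixel) (N), C.k = n →
    r + l = a + a → C.passes = gridPass a l l ::ₘ gridPass a r w ::ₘ N →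
    ∃ C' : GridCycle, C'.covers = C.covers ∧ C'.turns + 2 ≤ C.turns ∧ C'.k ≤ C.k := by
  induction n using Nat.strong_induction_on with
  | _ n ih =>
  intro C a l r w N hn hrl hC
  have hla : l ≠ a := (ne_of_pass_mem (C := C) (p := a) (x := l) (y := l) (by simp [hC])).1
  have hrl' : r ≠ l := by
    rintro rfl
    exact hla (add_self_eq_add_self_iff.1 hrl)
  by_cases hwl : w = l
  · subst hwl
    have hk := two_lt_k hC rfl
    obtain ⟨x, y, N2, hN2, C', hC'⟩ := exists_remove_uturn hk
      (show gridPass a w w ∈ C.passes by simp [hC])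
    have hN := hC.symm.trans hN2
    rw [Multiset.cons_inj_right] at hN
    obtain ⟨N3, rfl, hN3⟩ := Multiset.exists_cons_of_cons_eq_cons hN (gridPass_ne hla.symm)
    obtain ⟨N4, rfl, rfl⟩ := Multiset.exists_cons_of_cons_eq_cons hN3.symm (gridPass_ne hla.symm)
    have hcov : C'.covers = C.covers := by
      apply covers_congr
      intro p
      simp [hC', hN2]
      tauto
    have hkk : C'.k + 2 = C.k := by
      rw [← card_passes, ← card_passes, hC', hN2]; simp
    have hc2 := passCost_pass_self hla
    by_cases hxy : x = y ∧ x + a = w + w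
    · obtain ⟨rfl, hxa⟩ := hxy
      have hxa' : x ≠ a := by
        rintro rfl
        exact hla (add_self_eq_add_self_iff.1 hxa).symm
      obtain ⟨w', hw'⟩ := exists_adjacent_pass (C := C') (a := a) (r := r) (l := w)
        (by simp [hC'])
      have hw'' := hw'
      rw [hC', Multiset.mem_cons] at hw'
      rcases hw' with hw' | hw'
      · obtain ⟨-, ⟨h1, -⟩ | ⟨h1, -⟩⟩ := gridPass_inj hw' <;> exact absurd h1.symm hxa'
      · obtain ⟨N5, hN5⟩ := Multiset.exists_cons_of_mem hw'
        obtain ⟨D, hD1, hD2, hD3⟩ := ih C'.k (by omega) C' w x a w' N5 rfl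
          (by rw [add_comm, hxa]) (by rw [hC', hN5])
        refine ⟨D, hD1.trans hcov, hD2.trans ?_, by omega⟩
        rw [turns_eq, turns_eq, hC', hN2]
        have := passCost_le_two (gridPass w x x)
        simp only [Multiset.map_cons, Multiset.sum_cons]
        omega
    · refine ⟨C', hcov, ?_, by omega⟩
      have := passCost_triangle hxy
      rw [turns_eq, turns_eq, hC', hN2]
      simp only [Multiset.map_cons, Multiset.sum_cons]
      omega
  · obtain ⟨C', hC'⟩ := exists_exchange_uturn hC
    refine ⟨C', ?_, ?_, ?_⟩
    · apply covers_congr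
      intro p
      simp [hC', hC]
    · have h1 := passCost_pass_self hla
      have h2 : passCost (gridPass a l r) = 0 := passCost_straight (by rw [add_comm, hrl])
      rw [turns_eq, turns_eq, hC', hC]
      simp only [Multiset.map_cons, Multiset.sum_cons]
      suffices passCost (gridPass a l w) ≤ passCost (gridPass a r w) by omega
      have h3 := passCost_le_one (p := a) (Ne.symm hwl)
      have h4 : r + w ≠ a + a := by
        rw [← hrl]
        exact fun h => hwl (add_left_cancel h)
      rw [passCost_pass a r w, if_neg h4]
      split_ifs <;> omega
    · rw [← card_passes, ← card_passes, hC', hC]; simp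

/-- The penalty of a pass used to break ties: a straight pass is free, a simple turn costs `3`,
a U-turn costs `4`. -/
def passPenalty (q : Pixel × Multiset Pixel) : ℕ :=
  2 * passCost q + if passCost q = 1 then 1 else 0

/-- The total penalty of a cycle. -/
def penalty (C : GridCycle) : ℕ := (C.passes.map passPenalty).sum

/-- A cycle is reduced if no cycle with the same pixels and no more turns is shorter, or equally
long with a smaller penalty. -/
structure IsReduced (C : GridCycle) : Prop where
  k_le : ∀ C' : GridCycle, C'.covers = C.covers → C'.turns ≤ C.turns → C.k ≤ C'.k
  penalty_le : ∀ C' : GridCycle, C'.covers = C.covers → C'.turns ≤ C.turns → C'.k = C.k →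
    C.penalty ≤ C'.penalty

theorem exists_isReduced (C : GridCycle) :
    ∃ C' : GridCycle, C'.covers = C.covers ∧ C'.turns ≤ C.turns ∧ C'.IsReduced := by
  obtain ⟨C', hC', hmin⟩ := exists_minimalFor_of_wellFoundedLT
    (fun C' : GridCycle => C'.covers = C.covers ∧ C'.turns ≤ C.turns)
    (fun C' => toLex (C'.k, C'.penalty)) ⟨C, rfl, le_rfl⟩
  have key : ∀ D : GridCycle, D.covers = C'.covers → D.turns ≤ C'.turns →
      toLex (C'.k, C'.penalty) ≤ toLex (D.k, D.penalty) := by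
    intro D h1 h2
    by_contra hcon
    exact hcon (hmin ⟨h1.trans hC'.1, h2.trans hC'.2⟩ (le_of_not_ge hcon))
  refine ⟨C', hC'.1, hC'.2, fun D h1 h2 => ?_, fun D h1 h2 h3 => ?_⟩
  · have := key D h1 h2
    rw [Prod.Lex.toLex_le_toLex] at this
    simp only at this
    omega
  · have := key D h1 h2
    rw [Prod.Lex.toLex_le_toLex] at this
    simp only at this
    omega

/-- In a reduced cycle the pixel of a U-turn is visited only once. -/
theorem IsReduced.fst_ne_of_uturn {C : GridCycle} (hC : C.IsReduced) {a b : Pixel} {N}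
    (h : C.passes = gridPass a b b ::ₘ N) {q} (hq : q ∈ N) : q.1 ≠ a := by
  intro hqa
  have hba : b ≠ a := (ne_of_pass_mem (C := C) (p := a) (x := b) (y := b) (by simp [h])).1
  obtain ⟨N', rfl⟩ := Multiset.exists_cons_of_mem hq
  have hk := two_lt_k h hqa.symm
  obtain ⟨x, y, N2, hN2, C', hC'⟩ := exists_remove_uturn hk
    (show gridPass a b b ∈ C.passes by simp [h])
  have hN := h.symm.trans hN2
  rw [Multiset.cons_inj_right] at hN
  have hqb : ∀ z w, q ≠ gridPass b z w := fun z w e => hba (by rw [← hqa, e, gridPass_fst])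
  obtain ⟨N3, rfl, hN3⟩ := Multiset.exists_cons_of_cons_eq_cons hN (hqb _ _)
  obtain ⟨N4, rfl, rfl⟩ := Multiset.exists_cons_of_cons_eq_cons hN3.symm (hqb _ _)
  have hcov : C'.covers = C.covers := by
    apply covers_congr
    intro p
    simp [hC', hN2, hqa]
    tauto
  have hkk : C'.k + 2 = C.k := by
    rw [← card_passes, ← card_passes, hC', hN2]; simp
  have ht : C'.turns ≤ C.turns := by
    rw [turns_eq, turns_eq, hC', hN2]
    have := passCost_le_two (gridPass b x y)
    have := passCost_pass_self hba
    simp only [Multiset.map_cons, Multiset.sum_cons]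
    omega
  have := hC.k_le C' hcov ht
  omega

theorem IsReduced.ne_of_three_le_useCount {C : GridCycle} (hC : C.IsReduced) {a b x y : Pixel}
    (h : 3 ≤ useCount a b C.passes) (hm : gridPass a x y ∈ C.passes) : x ≠ y := by
  rintro rfl
  obtain ⟨N, hN⟩ := Multiset.exists_cons_of_mem hm
  rw [hN, useCount_pass_cons] at h
  have : useCount a b N = 0 := by
    by_contra h0
    obtain ⟨q, hq, hqa, -⟩ := exists_of_useCount_pos (Nat.pos_of_ne_zero h0)
    exact hC.fst_ne_of_uturn hN hq hqa
  rw [this] at h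
  split_ifs at h <;> omega

theorem exists_three_positions {C : GridCycle} {a b : Pixel} (h : 3 ≤ useCount a b C.passes)
    (hne : ∀ x y, gridPass a x y ∈ C.passes → x ≠ y) :
    ∃ i j h : ℕ, i < C.k ∧ j < C.k ∧ h < C.k ∧ i ≠ j ∧ i ≠ h ∧ j ≠ h ∧
      (C.pts i = a ∧ (C.pts (i - 1) = b ∨ C.pts (i + 1) = b)) ∧
      (C.pts j = a ∧ (C.pts (j - 1) = b ∨ C.pts (j + 1) = b)) ∧
      (C.pts h = a ∧ (C.pts (h - 1) = b ∨ C.pts (h + 1) = b)) := by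
  classical
  have hle : useCount a b C.passes ≤ ((Finset.range C.k).filter
      (fun i : ℕ => C.pts i = a ∧ (C.pts (i - 1) = b ∨ C.pts (i + 1) = b))).card := by
    rw [Finset.card_filter, useCount, passes, Multiset.map_map]
    change ∑ i ∈ Finset.range C.k, _ ≤ _
    apply Finset.sum_le_sum
    intro i _
    have hi := hne (C.pts (i - 1)) (C.pts (i + 1))
    simp only [Function.comp, passAt, gridPass, Multiset.insert_eq_cons, Multiset.count_cons,
      Multiset.count_singleton, eq_comm (a := b)]
    by_cases h1 : C.pts i = a
    · have := hi (by rw [← h1]; exact C.passAt_mem_passes i)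
      by_cases h2 : C.pts (i - 1) = b
      · have h3 : C.pts (i + 1) ≠ b := fun e => this (h2.trans e.symm)
        simp [h1, h2, h3]
      · simp [h1, h2]
    · simp [h1]
  obtain ⟨i, hi, j, hj, l, hl, hij, hil, hjl⟩ := Finset.two_lt_card.1 (lt_of_lt_of_le h hle)
  simp only [Finset.mem_filter, Finset.mem_range] at hi hj hl
  exact ⟨i, j, l, hi.1, hj.1, hl.1, hij, hil, hjl, hi.2, hj.2, hl.2⟩

/-- If three passes at `a` use `b`, then two of them can be reconnected to a U-turn at `a`
coming from `b`. -/
theorem exists_make_uturn {C : GridCycle} {a b : Pixel} (h : 3 ≤ useCount a b C.passes)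
    (hne : ∀ x y, gridPass a x y ∈ C.passes → x ≠ y) :
    ∃ x₁ x₂ x₃ N, C.passes = gridPass a x₁ b ::ₘ gridPass a x₂ b ::ₘ gridPass a x₃ b ::ₘ N ∧
      ∃ C' : GridCycle,
        C'.passes = gridPass a b b ::ₘ gridPass a x₁ x₂ ::ₘ gridPass a x₃ b ::ₘ N := by
  have key : ∀ i j h : ℕ, i < C.k → j < C.k → h < C.k → i ≠ j → i ≠ h → j ≠ h →
      C.pts i = a → C.pts j = a → C.pts h = a →
      (C.pts (h - 1) = b ∨ C.pts (h + 1) = b) →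
      (C.pts (i - 1) = b ∧ C.pts (j - 1) = b ∨ C.pts (i + 1) = b ∧ C.pts (j + 1) = b) →
      ∃ x₁ x₂ x₃ N,
        C.passes = gridPass a x₁ b ::ₘ gridPass a x₂ b ::ₘ gridPass a x₃ b ::ₘ N ∧
        ∃ C' : GridCycle,
          C'.passes = gridPass a b b ::ₘ gridPass a x₁ x₂ ::ₘ gridPass a x₃ b ::ₘ N := by
    intro i j h hi hj hh hij hih hjh hia hja hha hhb hijb
    obtain ⟨N, hN⟩ := exists_passes_eq hi hj hh hij hih hjh
    obtain ⟨C', hC'⟩ := C.exists_twoOpt hij hi hj (hia.trans hja.symm) hN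
    obtain ⟨x₃, hx₃⟩ : ∃ x₃, C.passAt h = gridPass a x₃ b := by
      rcases hhb with hb | hb
      · exact ⟨C.pts (h + 1), by rw [passAt, hha, hb, gridPass_comm]⟩
      · exact ⟨C.pts (h - 1), by rw [passAt, hha, hb]⟩
    rw [hx₃] at hN hC'
    rcases hijb with ⟨h1, h2⟩ | ⟨h1, h2⟩
    · refine ⟨C.pts (i + 1), C.pts (j + 1), x₃, N, ?_, C', ?_⟩
      · rw [hN, passAt, passAt, hia, hja, h1, h2, gridPass_comm _ b, gridPass_comm _ b]
      · rw [hC', hia, h1, h2]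
    · refine ⟨C.pts (i - 1), C.pts (j - 1), x₃, N, ?_, C', ?_⟩
      · rw [hN, passAt, passAt, hia, hja, h1, h2]
      · rw [hC', hia, h1, h2, Multiset.cons_swap]
  obtain ⟨i, j, l, hi, hj, hl, hij, hil, hjl, ⟨hia, hib⟩, ⟨hja, hjb⟩, hla, hlb⟩ :=
    exists_three_positions h hne
  have h1 := key i j l hi hj hl hij hil hjl hia hja hla hlb
  have h2 := key i l j hi hl hj hil hij hjl.symm hia hla hja hjb
  have h3 := key j l i hj hl hi hjl hij.symm hil.symm hja hla hia hib
  rcases hib with hib | hib <;> rcases hjb with hjb | hjb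
  · exact h1 (.inl ⟨hib, hjb⟩)
  · rcases hlb with hlb | hlb
    · exact h2 (.inl ⟨hib, hlb⟩)
    · exact h3 (.inr ⟨hjb, hlb⟩)
  · rcases hlb with hlb | hlb
    · exact h3 (.inl ⟨hjb, hlb⟩)
    · exact h2 (.inr ⟨hib, hlb⟩)
  · exact h1 (.inr ⟨hib, hjb⟩)

theorem useCount_self (C : GridCycle) (a : Pixel) : useCount a a C.passes = 0 := by
  by_contra h0
  obtain ⟨q, hq, rfl, hb⟩ := exists_of_useCount_pos (Nat.pos_of_ne_zero h0)
  obtain ⟨w, hw⟩ := eq_gridPass_of_mem hq hb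
  rw [hw] at hq
  exact (ne_of_pass_mem hq).1 rfl

/-- In a reduced cycle, a step used at least three times is preceded by such a step. -/
theorem IsReduced.three_le_useCount_of_opposite {C : GridCycle} (hC : C.IsReduced)
    {a b l : Pixel} (hl : l + b = a + a) (h : 3 ≤ useCount a b C.passes) :
    3 ≤ useCount a l C.passes := by
  by_contra! hal
  have hab : a ≠ b := by
    rintro rfl
    rw [useCount_self] at h
    omega
  have hba : 3 ≤ useCount b a C.passes := by rwa [useCount_comm]
  have hne : ∀ x y, gridPass a x y ∈ C.passes → x ≠ y :=
    fun x y => hC.ne_of_three_le_useCount h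
  obtain ⟨x₁, x₂, x₃, N, hN, C₁, hC₁⟩ := exists_make_uturn h hne
  have hnot : ¬(x₁ = l ∧ x₂ = l ∧ x₃ = l) := by
    rintro ⟨rfl, rfl, rfl⟩
    rw [hN] at hal
    simp only [useCount_pass_cons, if_true] at hal
    omega
  have hx₃b := hne x₃ b (by simp [hN])
  obtain ⟨x, y, N₂, hN₂, C₂, hC₂⟩ := exists_remove_uturn (two_lt_k hC₁ rfl)
    (show gridPass a b b ∈ C₁.passes by simp [hC₁])
  have e := hC₁.symm.trans hN₂
  rw [Multiset.cons_inj_right] at e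
  obtain ⟨S, hS, e1⟩ := Multiset.exists_cons_of_cons_eq_cons e (gridPass_ne hab)
  obtain ⟨T, rfl, rfl⟩ := Multiset.exists_cons_of_cons_eq_cons hS (gridPass_ne hab)
  obtain ⟨U, hU, rfl⟩ := Multiset.exists_cons_of_cons_eq_cons e1.symm (gridPass_ne hab)
  obtain ⟨W, rfl, rfl⟩ := Multiset.exists_cons_of_cons_eq_cons hU (gridPass_ne hab)
  clear e e1 hS hU hN₂ hC₁
  obtain ⟨C₃, r₁, r₂, hC₃, hr₁, hr₂, hcost⟩ : ∃ C₃ : GridCycle, ∃ r₁ r₂,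
      C₃.passes = gridPass b x y ::ₘ r₁ ::ₘ r₂ ::ₘ W ∧ r₁.1 = a ∧ r₂.1 = a ∧
      passCost r₁ + passCost r₂ ≤ passCost (gridPass a x₁ b) + passCost (gridPass a x₂ b) +
        passCost (gridPass a x₃ b) := by
    by_cases h12 : x₁ = x₂ ∧ x₁ + b = a + a
    · obtain ⟨rfl, h1⟩ := h12
      have h1l : x₁ = l := add_right_cancel (h1.trans hl.symm)
      subst h1l
      have h3 : x₃ ≠ x₁ := fun e => hnot ⟨rfl, rfl, e⟩
      obtain ⟨C₃, hC₃⟩ := exists_exchange_uturn (C := C₂) (a := a) (l := x₁) (y := x₃) (z := b)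
        (N := gridPass b x y ::ₘ W) (by
          rw [hC₂, Multiset.cons_swap, Multiset.cons_swap (gridPass b x y)])
      refine ⟨C₃, gridPass a x₁ x₃, gridPass a x₁ b, ?_, rfl, rfl, ?_⟩
      · rw [hC₃, Multiset.cons_swap _ (gridPass b x y), Multiset.cons_swap _ (gridPass b x y)]
      · have h4 : x₃ + b ≠ a + a := by
          rw [← hl]
          exact fun e => h3 (add_right_cancel e)
        rw [passCost_straight hl, passCost_turn h4 hx₃b]
        have := passCost_le_one (p := a) h3.symm
        omega
    · refine ⟨C₂, _, _, hC₂, rfl, rfl, ?_⟩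
      have := passCost_triangle h12
      rw [gridPass_comm a b] at this
      omega
  have hcov : C₃.covers = C.covers := by
    apply covers_congr
    intro p
    simp [hC₃, hN, hr₁, hr₂]
    tauto
  have hkk : C₃.k + 2 = C.k := by
    rw [← card_passes, ← card_passes, hC₃, hN]; simp
  have hfinal : ∀ C' : GridCycle, C'.covers = C₃.covers → C'.turns ≤ C.turns → C'.k ≤ C₃.k →
      False := by
    intro C' h1 h2 h3
    have := hC.k_le C' (h1.trans hcov) h2
    omega
  by_cases hxy : x = y ∧ x + a = b + b
  · obtain ⟨rfl, hxa⟩ := hxy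
    have hxa' : x ≠ a := by
      rintro rfl
      exact hab (add_self_eq_add_self_iff.1 hxa)
    have hpos : 0 < useCount b a W := by
      rw [hN] at hba
      simp only [useCount_pass_cons, if_neg hab, if_neg hxa', if_true] at hba
      omega
    obtain ⟨q, hq, hqb, hqa⟩ := exists_of_useCount_pos hpos
    obtain ⟨w, hw⟩ := eq_gridPass_of_mem (C := C) (by rw [hN]; simp [hq]) hqa
    rw [hqb] at hw
    subst hw
    obtain ⟨W', rfl⟩ := Multiset.exists_cons_of_mem hq
    obtain ⟨C₄, h1, h2, h3⟩ := exists_save_two_turns C₃.k C₃ b x a w (r₁ ::ₘ r₂ ::ₘ W') rfl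
      (by rw [add_comm, hxa]) (by
        rw [hC₃, Multiset.cons_swap r₂, Multiset.cons_swap r₁])
    refine hfinal C₄ h1 ?_ h3
    have := passCost_le_two (gridPass b x x)
    have : C₃.turns ≤ C.turns + 2 := by
      rw [turns_eq, turns_eq, hC₃, hN]
      simp only [Multiset.map_cons, Multiset.sum_cons]
      omega
    omega
  · refine hfinal C₃ rfl ?_ le_rfl
    have := passCost_triangle hxy
    rw [turns_eq, turns_eq, hC₃, hN]
    simp only [Multiset.map_cons, Multiset.sum_cons]
    omega

theorem covers_finite (C : GridCycle) : C.covers.Finite := by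
  have : C.covers = Prod.fst '' {q | q ∈ C.passes} := by
    ext p
    rw [mem_covers_iff]
    rfl
  rw [this]
  exact (Multiset.finite_toSet C.passes).image _

/-- A reduced cycle uses every step at most twice. -/
theorem IsReduced.useCount_le_two {C : GridCycle} (hC : C.IsReduced) (a b : Pixel) :
    useCount a b C.passes ≤ 2 := by
  by_contra! h
  have hab : b - a ≠ 0 := by
    intro e
    rw [sub_eq_zero.1 e, useCount_self] at h
    omega
  have hall : ∀ n : ℕ, 3 ≤ useCount (a - n • (b - a)) (a - n • (b - a) + (b - a)) C.passes := by
    intro n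
    induction n with
    | zero => rw [zero_nsmul, sub_zero, add_sub_cancel]; exact h
    | succ n ih =>
      have := hC.three_le_useCount_of_opposite (l := a - (n + 1) • (b - a))
        (by rw [succ_nsmul]; abel) ih
      rw [useCount_comm] at this
      convert this using 2
      rw [succ_nsmul]; abel
  refine Set.infinite_of_injective_forall_mem (f := fun n : ℕ => a - n • (b - a)) ?_ (fun n => ?_)
    C.covers_finite
  · intro m n hmn
    have h1 : m • (b - a) = n • (b - a) := sub_right_injective hmn
    have h2 : (m : ℤ) • (b - a) = (n : ℤ) • (b - a) := by simpa only [natCast_zsmul] using h1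
    exact Nat.cast_injective (smul_left_injective ℤ hab h2)
  · obtain ⟨q, hq, hqa, -⟩ := exists_of_useCount_pos (lt_of_lt_of_le (by norm_num) (hall n))
    exact (C.mem_covers_iff _).2 ⟨q, hq, hqa⟩

/-- A reduced cycle leaves a pixel `p` at most twice along a line through `p`. -/
theorem IsReduced.card_le_two {C : GridCycle} (hC : C.IsReduced) {p l r : Pixel}
    (hlr : l + r = p + p) (hne : l ≠ r) :
    ((Finset.range C.k).filter
      (fun i : ℕ => C.pts i = p ∧ (C.pts (i + 1) = l ∨ C.pts (i + 1) = r))).card ≤ 2 := by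
  have key : ∀ (l r : Pixel), l + r = p + p → l ≠ r → ∀ i j h : ℕ, i < C.k → j < C.k → h < C.k →
      i ≠ j → i ≠ h → j ≠ h → C.pts i = p → C.pts j = p → C.pts h = p → C.pts (i + 1) = l →
      C.pts (j + 1) = l → C.pts (h + 1) = l ∨ C.pts (h + 1) = r → False := by
    intro l r hlr hne i j h hi hj hh hij hih hjh hip hjp hhp hil hjl hhlr
    wlog hx : C.pts (i - 1) ≠ r generalizing i j
    · refine this j i hj hi hij.symm hjh hih hjp hip hjl hil fun hjr => ?_
      rw [not_not] at hx
      obtain ⟨N, hN⟩ := exists_passes_eq hi hj hh hij hih hjh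
      have h1 := hC.useCount_le_two p l
      have h2 := hC.useCount_le_two p r
      rw [hN] at h1 h2
      simp only [passAt, useCount_pass_cons, hip, hjp, hhp, hil, hjl, hx, hjr, if_true] at h1 h2
      rcases hhlr with e | e <;> simp only [e, if_true] at h1 h2 <;> omega
    obtain ⟨N, hN⟩ := exists_passes_eq hi hj hh hij hih hjh
    have h1 := hC.useCount_le_two p l
    rw [hN] at h1
    simp only [passAt, useCount_pass_cons, hip, hjp, hhp, hil, hjl, if_true] at h1
    have hil' : C.pts (i - 1) ≠ l := fun e => by rw [if_pos e] at h1; omega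
    have hhl' : C.pts (h - 1) ≠ l := fun e => by rw [if_pos e] at h1; omega
    have hhl : C.pts (h + 1) ≠ l := fun e => by rw [if_pos e] at h1; omega
    have hhr : C.pts (h + 1) = r := hhlr.resolve_left hhl
    have hN' : C.passes = C.passAt i ::ₘ C.passAt h ::ₘ C.passAt j ::ₘ N := by
      rw [hN, Multiset.cons_swap (C.passAt j)]
    obtain ⟨C', hC'⟩ := C.exists_twoOpt hih hi hh (hip.trans hhp.symm) hN'
    have hcov : C'.covers = C.covers := by
      apply covers_congr
      intro q
      simp [hC', hN', passAt, hip, hhp]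
    have hkk : C'.k = C.k := by
      rw [← card_passes, ← card_passes, hC', hN']; simp
    rw [passAt, passAt, hip, hhp, hil, hhr] at hN'
    rw [hip, hil, hhr] at hC'
    generalize C.pts (i - 1) = v at *
    generalize C.pts (h - 1) = x at *
    have hrp : r ≠ p := by
      rintro rfl
      exact hne (add_right_cancel hlr)
    have c1 : passCost (gridPass p l r) = 0 := passCost_straight hlr
    have c2 : passCost (gridPass p v l) = 1 := passCost_turn (by
      rw [← hlr, add_comm l r]
      exact fun e => hx (add_right_cancel e)) hil'
    have c3 : 1 ≤ passCost (gridPass p x r) := by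
      rw [passCost_pass, if_neg (by rw [← hlr]; exact fun e => hhl' (add_right_cancel e))]
      split_ifs <;> omega
    have c4 : passCost (gridPass p v x) ≤ 1 ∧ passCost (gridPass p x r) = 2 ∨
        passCost (gridPass p v x) ≤ 2 ∧ passCost (gridPass p x r) = 1 := by
      by_cases hxr : x = r
      · subst hxr
        exact .inl ⟨passCost_le_one hx, passCost_pass_self hrp⟩
      · exact .inr ⟨passCost_le_two _,
          passCost_turn (by rw [← hlr]; exact fun e => hhl' (add_right_cancel e)) hxr⟩
    have := hC.penalty_le C' hcov (by
      rw [turns_eq, turns_eq, hC', hN']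
      simp only [Multiset.map_cons, Multiset.sum_cons]
      omega) hkk
    rw [penalty, penalty, hC', hN'] at this
    simp only [Multiset.map_cons, Multiset.sum_cons, passPenalty, c1, c2] at this
    split_ifs at this <;> omega
  by_contra! hcard
  obtain ⟨i, hi, j, hj, h, hh, hij, hih, hjh⟩ := Finset.two_lt_card.1 hcard
  simp only [Finset.mem_filter, Finset.mem_range] at hi hj hh
  obtain ⟨hi, hip, hio⟩ := hi
  obtain ⟨hj, hjp, hjo⟩ := hj
  obtain ⟨hh, hhp, hho⟩ := hh
  have hrl : r + l = p + p := by rw [add_comm, hlr]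
  rcases hio with hio' | hio' <;> rcases hjo with hjo' | hjo'
  · exact key l r hlr hne i j h hi hj hh hij hih hjh hip hjp hhp hio' hjo' hho
  · rcases hho with hho' | hho'
    · exact key l r hlr hne i h j hi hh hj hih hij hjh.symm hip hhp hjp hio' hho' (.inr hjo')
    · exact key r l hrl hne.symm j h i hj hh hi hjh hij.symm hih.symm hjp hhp hip hjo' hho' (.inr hio')
  · rcases hho with hho' | hho'
    · exact key l r hlr hne j h i hj hh hi hjh hij.symm hih.symm hjp hhp hip hjo' hho' (.inr hio')
    · exact key r l hrl hne.symm i h j hi hh hj hih hij hjh.symm hip hhp hjp hio' hho' (.inr hjo')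
  · exact key r l hrl hne.symm i j h hi hj hh hij hih hjh hip hjp hhp hio' hjo' hho.symm

end GridCycle

theorem Adjacent.horizontal {p q : Pixel} (h : Adjacent p q) (h2 : q.2 = p.2) :
    q = p - (1, 0) ∨ q = p + (1, 0) := by
  simp only [Adjacent, h2, sub_self, abs_zero, add_zero] at h
  simp only [Prod.ext_iff, Prod.fst_sub, Prod.snd_sub, Prod.fst_add, Prod.snd_add]
  rcases abs_eq (by norm_num) |>.1 h with h | h
  · left; constructor <;> omega
  · right; constructor <;> omega

theorem Adjacent.vertical {p q : Pixel} (h : Adjacent p q) (h1 : q.1 = p.1) :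
    q = p - (0, 1) ∨ q = p + (0, 1) := by
  simp only [Adjacent, h1, sub_self, abs_zero, zero_add] at h
  simp only [Prod.ext_iff, Prod.fst_sub, Prod.snd_sub, Prod.fst_add, Prod.snd_add]
  rcases abs_eq (by norm_num) |>.1 h with h | h
  · left; constructor <;> omega
  · right; constructor <;> omega

theorem Adjacent.eq_or_eq {p q : Pixel} (h : Adjacent p q) : q.2 = p.2 ∨ q.1 = p.1 := by
  simp only [Adjacent] at h
  rcases abs_cases (p.1 - q.1) with h1 | h1 <;> rcases abs_cases (p.2 - q.2) with h2 | h2 <;> omega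

namespace GridCycle

theorem covers_eq_image (C : GridCycle) :
    C.covers = (fun i : ℕ => C.pts i) '' (Finset.range C.k : Set ℕ) := by
  ext p
  constructor
  · rw [mem_covers_iff]
    rintro ⟨q, hq, rfl⟩
    obtain ⟨i, hi, rfl⟩ := exists_of_mem_passes hq
    exact ⟨i, by simpa using hi, rfl⟩
  · rintro ⟨i, _, rfl⟩
    exact ⟨i, rfl⟩

theorem ncard_covers_le (C : GridCycle) : C.covers.ncard ≤ C.k := by
  rw [covers_eq_image]
  refine (Set.ncard_image_le (Finset.finite_toSet _)).trans ?_
  rw [Set.ncard_coe_finset, Finset.card_range]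

theorem k_le_mul_ncard (C : GridCycle) (m : ℕ)
    (h : ∀ p, ((Finset.range C.k).filter (fun i : ℕ => C.pts i = p)).card ≤ m) :
    C.k ≤ m * C.covers.ncard := by
  have h1 := Finset.card_le_mul_card_image (f := fun i : ℕ => C.pts i) (Finset.range C.k) m
    (fun p _ => h p)
  rwa [Finset.card_range, ← Set.ncard_coe_finset, Finset.coe_image, ← covers_eq_image] at h1

end GridCycle

/-- Coverage reduction: for every tour of a region `P` with `t` turns there is
a tour of `P` with at most `t` turns in which every pixel occurs at most twice
in horizontal passes and at most twice in vertical passes, hence at most 4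
times in total; in particular its length is at most `4·|P|` and at most 4
times the minimum length of a tour of `P`. -/
theorem tour_coverage_at_most_four (P : Set Pixel) (hP : IsRegion P)
    (C : GridCycle) (hC : IsTour P C) :
    ∃ C' : GridCycle, IsTour P C' ∧ C'.turns ≤ C.turns ∧
      (∀ p : Pixel,
        ((Finset.range C'.k).filter
          (fun (i : ℕ) => C'.pts (i : ℤ) = p ∧
            (C'.pts ((i : ℤ) + 1)).2 = (C'.pts (i : ℤ)).2)).card ≤ 2 ∧
        ((Finset.range C'.k).filter
          (fun (i : ℕ) => C'.pts (i : ℤ) = p ∧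
            (C'.pts ((i : ℤ) + 1)).1 = (C'.pts (i : ℤ)).1)).card ≤ 2 ∧
        ((Finset.range C'.k).filter (fun (i : ℕ) => C'.pts (i : ℤ) = p)).card ≤ 4) ∧
      C'.k ≤ 4 * P.ncard ∧
      ∀ C'' : GridCycle, IsTour P C'' → C'.k ≤ 4 * C''.k := by
  obtain ⟨C', hcov, ht, hC'⟩ := C.exists_isReduced
  have hT : C'.covers = P := hcov.trans hC
  have hH : ∀ p : Pixel, ((Finset.range C'.k).filter
      (fun (i : ℕ) => C'.pts (i : ℤ) = p ∧
        (C'.pts ((i : ℤ) + 1)).2 = (C'.pts (i : ℤ)).2)).card ≤ 2 := by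
    intro p
    refine le_trans (Finset.card_le_card ?_)
      (hC'.card_le_two (p := p) (l := p - (1, 0)) (r := p + (1, 0)) (by abel) ?_)
    · intro i
      simp only [Finset.mem_filter]
      rintro ⟨h1, rfl, h3⟩
      exact ⟨h1, rfl, (C'.adj i).horizontal h3⟩
    · intro h
      have := congrArg Prod.fst h
      simp only [Prod.fst_sub, Prod.fst_add] at this
      omega
  have hV : ∀ p : Pixel, ((Finset.range C'.k).filter
      (fun (i : ℕ) => C'.pts (i : ℤ) = p ∧
        (C'.pts ((i : ℤ) + 1)).1 = (C'.pts (i : ℤ)).1)).card ≤ 2 := by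
    intro p
    refine le_trans (Finset.card_le_card ?_)
      (hC'.card_le_two (p := p) (l := p - (0, 1)) (r := p + (0, 1)) (by abel) ?_)
    · intro i
      simp only [Finset.mem_filter]
      rintro ⟨h1, rfl, h3⟩
      exact ⟨h1, rfl, (C'.adj i).vertical h3⟩
    · intro h
      have := congrArg Prod.snd h
      simp only [Prod.snd_sub, Prod.snd_add] at this
      omega
  have hA : ∀ p : Pixel,
      ((Finset.range C'.k).filter (fun (i : ℕ) => C'.pts (i : ℤ) = p)).card ≤ 4 := by
    intro p
    refine le_trans (Finset.card_le_card ?_) ((Finset.card_union_le _ _).trans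
      (add_le_add (hH p) (hV p)))
    intro i
    simp only [Finset.mem_filter, Finset.mem_union]
    rintro ⟨h1, h2⟩
    rcases (C'.adj i).eq_or_eq with h | h
    · exact .inl ⟨h1, h2, h⟩
    · exact .inr ⟨h1, h2, h⟩
  have hk : C'.k ≤ 4 * P.ncard := by
    rw [← hT]
    exact C'.k_le_mul_ncard 4 hA
  refine ⟨C', hT, ht, fun p => ⟨hH p, hV p, hA p⟩, hk, fun C'' hC'' => hk.trans ?_⟩
  have h2 := C''.ncard_covers_le
  rw [show C''.covers = P from hC''] at h2
  omega
end

section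
/- Let P be a region with at least two pixels and let R be a maximal rook placement in P. Then P admits a cycle cover with at most 10·|R| turns and a tour with at most 12·|R| − 2 turns. Since every tour of P has at least |R| turns, the latter tour has at most 12 times the minimum number of turns of a tour of P. -/
/-- The four unit steps. -/
def unitSteps : Finset Pixel := {(1, 0), (-1, 0), (0, 1), (0, -1)}

/-- The cost of leaving a pixel in direction `b` after having arrived in direction `a`. -/
def bend (a b : Pixel) : ℕ := if b = a then 0 else if b = -a then 2 else 1

theorem mem_unitSteps {d : Pixel} :
    d ∈ unitSteps ↔ d = (1, 0) ∨ d = (-1, 0) ∨ d = (0, 1) ∨ d = (0, -1) := by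
  simp [unitSteps]

theorem neg_mem_unitSteps {d : Pixel} (hd : d ∈ unitSteps) : -d ∈ unitSteps := by
  revert d; decide

theorem ne_zero_of_mem_unitSteps {d : Pixel} (hd : d ∈ unitSteps) : d ≠ 0 := by
  revert d; decide

theorem bend_self (a : Pixel) : bend a a = 0 := by simp [bend]

theorem bend_neg {d : Pixel} (hd : d ∈ unitSteps) : bend d (-d) = 2 := by
  revert d; decide

theorem bend_neg' {d : Pixel} (hd : d ∈ unitSteps) : bend (-d) d = 2 := by
  revert d; decide

theorem bend_le_two (a b : Pixel) : bend a b ≤ 2 := by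
  unfold bend; split_ifs <;> omega

theorem bend_perp {a b : Pixel} (h₁ : b ≠ a) (h₂ : b ≠ -a) : bend a b = 1 := by
  simp [bend, h₁, h₂]

theorem exists_bend_add_bend_le :
    ∀ a ∈ unitSteps, ∀ b ∈ unitSteps, ∀ d ∈ unitSteps,
      bend a d + bend d b ≤ bend a b + 2 ∨ bend a (-d) + bend (-d) b ≤ bend a b + 2 := by
  decide

theorem bend_add_bend_neg_le :
    ∀ a ∈ unitSteps, ∀ b ∈ unitSteps, ∀ h ∈ unitSteps,
      bend a h + bend (-h) b ≤ bend a b + 2 := by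
  decide

theorem bend_add_bend_neg_le_of_ne :
    ∀ a ∈ unitSteps, ∀ b ∈ unitSteps, ∀ h ∈ unitSteps, ∀ d ∈ unitSteps, d ≠ h → d ≠ -h →
      a ≠ -h → b ≠ h → a ≠ -d → b ≠ d → bend a h + bend (-h) b ≤ bend a b := by
  decide

theorem eq_or_eq_neg_of_perp :
    ∀ d ∈ unitSteps, ∀ e ∈ unitSteps, ∀ h ∈ unitSteps, h ≠ d → h ≠ -d → h ≠ e → h ≠ -e →
      e = d ∨ e = -d := by
  decide

theorem sub_mem_unitSteps {p q : Pixel} (h : Adjacent p q) : q - p ∈ unitSteps := by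
  rw [mem_unitSteps]
  obtain ⟨a, b⟩ := p
  obtain ⟨c, d⟩ := q
  simp only [Adjacent, Prod.mk_sub_mk, Prod.mk.injEq] at *
  rcases abs_cases (a - c) with h1 | h1 <;> rcases abs_cases (b - d) with h2 | h2 <;> omega

theorem adjacent_add {p d : Pixel} (hd : d ∈ unitSteps) : Adjacent p (p + d) := by
  rw [mem_unitSteps] at hd
  rcases hd with rfl | rfl | rfl | rfl <;> simp [Adjacent]

/-- `Walk s t S n`: starting at pixel `s.1`, having arrived there in direction `s.2`, there is a
nonempty walk ending at `t.1` with last step `t.2`, whose pixels after the first form `S`, of total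
turn cost `n` (the turn at the first pixel included, the one at the last pixel excluded). -/
inductive Walk : Pixel × Pixel → Pixel × Pixel → Set Pixel → ℕ → Prop
  | single (s : Pixel × Pixel) (d : Pixel) (hd : d ∈ unitSteps) :
      Walk s (s.1 + d, d) {s.1 + d} (bend s.2 d)
  | cons (s t : Pixel × Pixel) (d : Pixel) (S : Set Pixel) (n : ℕ) (hd : d ∈ unitSteps) :
      Walk (s.1 + d, d) t S n → Walk s t (insert (s.1 + d) S) (bend s.2 d + n)

namespace Walk

theorem trans {s t u : Pixel × Pixel} {A B : Set Pixel} {m n : ℕ} (h₁ : Walk s t A m)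
    (h₂ : Walk t u B n) : Walk s u (A ∪ B) (m + n) := by
  induction h₁ with
  | single s d hd =>
    rw [Set.singleton_union]
    exact cons _ _ _ _ _ hd h₂
  | cons s t d S k hd _ ih =>
    rw [Set.insert_union, add_assoc]
    exact cons _ _ _ _ _ hd (ih h₂)

theorem congr {s t t' : Pixel × Pixel} {A B : Set Pixel} {m n : ℕ} (h : Walk s t A m)
    (ht : t = t') (hA : A = B) (hn : m = n) : Walk s t' B n := by
  subst ht hA hn; exact h

theorem final_mem {s t : Pixel × Pixel} {A : Set Pixel} {m : ℕ} (h : Walk s t A m) : t.1 ∈ A := by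
  induction h with
  | single => simp
  | cons => right; assumption

theorem step_mem {s t : Pixel × Pixel} {A : Set Pixel} {m : ℕ} (h : Walk s t A m) :
    t.2 ∈ unitSteps := by
  induction h with
  | single => assumption
  | cons => assumption

theorem sub_step {s t : Pixel × Pixel} {A : Set Pixel} {m : ℕ} (h : Walk s t A m) :
    t.1 - t.2 = s.1 ∨ t.1 - t.2 ∈ A := by
  induction h with
  | single s d => left; simp
  | cons s t d S n hd _ ih =>
    right
    rcases ih with ih | ih
    · left; exact ih
    · right; exact ih

theorem sub_step_of_closed {s : Pixel × Pixel} {A : Set Pixel} {m : ℕ} (h : Walk s s A m) :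
    s.1 - s.2 ∈ A := by
  rcases h.sub_step with h' | h'
  · rw [h']; exact h.final_mem
  · exact h'

theorem redirect {s t : Pixel × Pixel} {A : Set Pixel} {n : ℕ} (h : Walk s t A n) :
    ∃ b ∈ unitSteps, s.1 + b ∈ A ∧
      ∃ m, n = bend s.2 b + m ∧ ∀ a, Walk (s.1, a) t A (bend a b + m) := by
  cases h with
  | single _ d hd => exact ⟨d, hd, rfl, 0, rfl, fun a => single (s.1, a) d hd⟩
  | cons _ _ d S m hd h => exact ⟨d, hd, Or.inl rfl, m, rfl, fun a => cons (s.1, a) _ d S m hd h⟩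

theorem split {s t : Pixel × Pixel} {A : Set Pixel} {n : ℕ} (h : Walk s t A n) {p : Pixel}
    (hp : p ∈ A) : ∃ a, t = (p, a) ∨ ∃ B C k m, Walk s (p, a) B k ∧ Walk (p, a) t C m ∧
      B ∪ C = A ∧ k + m = n := by
  induction h with
  | single s d => rw [Set.mem_singleton_iff] at hp; exact ⟨d, Or.inl (by rw [hp])⟩
  | cons s t d S n hd h ih =>
    rcases hp with hp | hp
    · subst hp
      exact ⟨d, Or.inr ⟨_, _, _, _, single s d hd, h, Set.singleton_union, rfl⟩⟩
    · obtain ⟨a, ha | ⟨B, C, k, m, h₁, h₂, h₃, h₄⟩⟩ := ih hp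
      · exact ⟨a, Or.inl ha⟩
      · exact ⟨a, Or.inr ⟨_, _, _, _, cons _ _ _ _ _ hd h₁, h₂, by rw [← h₃, Set.insert_union],
          by rw [← h₄, add_assoc]⟩⟩

theorem rotate {s : Pixel × Pixel} {A : Set Pixel} {n : ℕ} (h : Walk s s A n) {p : Pixel}
    (hp : p ∈ A) : ∃ a, Walk (p, a) (p, a) A n := by
  obtain ⟨a, ha | ⟨B, C, k, m, h₁, h₂, h₃, h₄⟩⟩ := h.split hp
  · exact ⟨a, ha ▸ h⟩
  · exact ⟨a, (h₂.trans h₁).congr rfl (by rw [Set.union_comm, h₃]) (by rw [add_comm, h₄])⟩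

theorem exists_states {s t : Pixel × Pixel} {A : Set Pixel} {n : ℕ} (h : Walk s t A n) :
    ∃ (k : ℕ) (f : ℕ → Pixel × Pixel), 0 < k ∧ f 0 = s ∧ f k = t ∧
      (∀ i < k, (f (i + 1)).2 ∈ unitSteps ∧ (f (i + 1)).1 = (f i).1 + (f (i + 1)).2) ∧
      A = {p | ∃ i < k, p = (f (i + 1)).1} ∧
      n = ∑ i ∈ Finset.range k, bend (f i).2 (f (i + 1)).2 := by
  induction h with
  | single s d hd =>
    refine ⟨1, fun i => if i = 0 then s else (s.1 + d, d), one_pos, rfl, rfl, ?_, ?_, ?_⟩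
    · intro i hi
      obtain rfl : i = 0 := by omega
      simp [hd]
    · ext p; simp
    · simp
  | cons s t d S n hd h ih =>
    obtain ⟨k, f, hk, h0, h1, h2, h3, h4⟩ := ih
    refine ⟨k + 1, fun i => Nat.casesOn i s f, by omega, rfl, h1, ?_, ?_, ?_⟩
    · intro i hi
      cases i with
      | zero => simp [h0, hd]
      | succ i => exact h2 i (by omega)
    · ext p
      simp only [h3, Set.mem_insert_iff, Set.mem_ofPred_eq]
      constructor
      · rintro (rfl | ⟨i, hi, rfl⟩)
        · exact ⟨0, by omega, by simp [h0]⟩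
        · exact ⟨i + 1, by omega, rfl⟩
      · rintro ⟨i, hi, rfl⟩
        cases i with
        | zero => left; simp [h0]
        | succ i => right; exact ⟨i, by omega, rfl⟩
    · rw [Finset.sum_range_succ', h4, add_comm]
      simp [h0]

theorem exists_gridCycle {s : Pixel × Pixel} {A : Set Pixel} {n : ℕ} (h : Walk s s A n) :
    ∃ C : GridCycle, C.covers = A ∧ C.turns = n := by
  obtain ⟨k, f, hk, h0, h1, h2, h3, h4⟩ := h.exists_states
  have hk2 : 2 ≤ k := by
    by_contra hlt
    obtain rfl : k = 1 := by omega
    obtain ⟨h5, h6⟩ := h2 0 one_pos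
    rw [h0, zero_add, h1] at h6
    rw [zero_add, h1] at h5
    exact ne_zero_of_mem_unitSteps h5 (by simpa using h6.symm)
  set g : ℤ → Pixel × Pixel := fun i => f (i % k).toNat with hg
  have hgn : ∀ i : ℕ, i < k → g i = f i := by
    intro i hi
    simp only [hg]
    rw [Int.emod_eq_of_lt (by omega) (by omega), Int.toNat_natCast]
  have hsucc : ∀ i : ℤ, g (i + 1) = f ((i % k).toNat + 1) := by
    intro i
    have hlt := Int.emod_lt_of_pos i (show (0 : ℤ) < k by omega)
    have hnn := Int.emod_nonneg i (show (k : ℤ) ≠ 0 by omega)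
    simp only [hg]
    rw [← Int.emod_add_emod]
    by_cases hc : i % k + 1 = k
    · rw [hc, Int.emod_self, Int.toNat_zero, h0, show (i % k).toNat + 1 = k by omega, h1]
    · rw [Int.emod_eq_of_lt (by omega) (by omega)]
      congr 1; omega
  have hlt : ∀ i : ℤ, (i % k).toNat < k := by
    intro i
    have hlt := Int.emod_lt_of_pos i (show (0 : ℤ) < k by omega)
    have hnn := Int.emod_nonneg i (show (k : ℤ) ≠ 0 by omega)
    omega
  have hstep : ∀ i : ℤ, (g (i + 1)).2 ∈ unitSteps ∧ (g (i + 1)).1 = (g i).1 + (g (i + 1)).2 := by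
    intro i
    rw [hsucc]
    exact h2 _ (hlt i)
  let C : GridCycle :=
    { k := k
      two_le := hk2
      pts := fun i => (g i).1
      periodic := by intro i; simp [hg]
      adj := by
        intro i
        rw [(hstep i).2]
        exact adjacent_add (hstep i).1 }
  refine ⟨C, ?_, ?_⟩
  · rw [h3]
    ext p
    constructor
    · rintro ⟨i, rfl⟩
      refine ⟨_, hlt (i - 1), ?_⟩
      rw [← hsucc, sub_add_cancel]
    · rintro ⟨i, hi, rfl⟩
      refine ⟨(i : ℤ) + 1, ?_⟩
      change (g (i + 1)).1 = _
      rw [hsucc, Int.emod_eq_of_lt (by omega) (by omega), Int.toNat_natCast]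
  · rw [h4]
    apply Finset.sum_congr rfl
    intro i hi
    have hi : i < k := Finset.mem_range.1 hi
    have e1 : C.pts (i + 1) - C.pts i = (g (i + 1)).2 := by
      change (g (i + 1)).1 - (g i).1 = _
      rw [(hstep i).2, add_sub_cancel_left]
    have e2 : C.pts i - C.pts (i - 1) = (g i).2 := by
      have := (hstep (i - 1)).2
      rw [sub_add_cancel] at this
      change (g i).1 - (g (i - 1)).1 = _
      rw [this, add_sub_cancel_left]
    rw [GridCycle.turnCost, e1, e2, hsucc, hgn i hi, Int.emod_eq_of_lt (by omega) (by omega),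
      Int.toNat_natCast, bend]

theorem straight (s : Pixel × Pixel) {d : Pixel} (hd : d ∈ unitSteps) (n : ℕ) :
    Walk s (s.1 + ((n : ℤ) + 1) • d, d) {q | ∃ j : ℕ, j ≤ n ∧ q = s.1 + ((j : ℤ) + 1) • d}
      (bend s.2 d) := by
  induction n with
  | zero =>
    refine (single s d hd).congr (by simp) ?_ rfl
    ext q; simp
  | succ n ih =>
    refine (ih.trans (single _ d hd)).congr ?_ ?_ (by simp [bend_self])
    · ext <;> simp <;> ring
    · ext q
      simp only [Set.mem_union, Set.mem_ofPred_eq, Set.mem_singleton_iff]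
      constructor
      · rintro (⟨j, hj, rfl⟩ | rfl)
        · exact ⟨j, by omega, rfl⟩
        · exact ⟨n + 1, le_rfl, by ext <;> simp <;> ring⟩
      · rintro ⟨j, hj, rfl⟩
        rcases Nat.lt_or_ge n j with h | h
        · obtain rfl : j = n + 1 := by omega
          right; ext <;> simp <;> ring
        · left; exact ⟨j, h, rfl⟩

end Walk

/-- The pixels of the straight run of `P` through `p` in direction `±d`. -/
def line (P : Set Pixel) (d p : Pixel) : Set Pixel :=
  {q | ∃ z : ℤ, q = p + z • d ∧ ∀ w : ℤ, min 0 z ≤ w → w ≤ max 0 z → p + w • d ∈ P}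

/-- The pixels of the straight run of `P` starting at `p` in direction `d`. -/
def ray (P : Set Pixel) (d p : Pixel) : Set Pixel :=
  {q | ∃ j : ℕ, q = p + (j : ℤ) • d ∧ ∀ i : ℕ, i ≤ j → p + (i : ℤ) • d ∈ P}

section Lines

variable {P : Set Pixel} {d p q : Pixel}

theorem line_subset : line P d p ⊆ P := by
  rintro q ⟨z, rfl, hz⟩
  exact hz z (by omega) (by omega)

theorem self_mem_line (hp : p ∈ P) : p ∈ line P d p := by
  refine ⟨0, by simp, fun w h1 h2 => ?_⟩
  obtain rfl : w = 0 := by omega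
  simpa using hp

theorem mem_line_symm (h : q ∈ line P d p) : p ∈ line P d q := by
  obtain ⟨z, rfl, hz⟩ := h
  refine ⟨-z, by simp, fun w h1 h2 => ?_⟩
  have := hz (z + w) (by omega) (by omega)
  rwa [add_smul, ← add_assoc] at this

theorem mem_line_trans {r : Pixel} (h₁ : q ∈ line P d p) (h₂ : r ∈ line P d q) :
    r ∈ line P d p := by
  obtain ⟨z, rfl, hz⟩ := h₁
  obtain ⟨y, rfl, hy⟩ := h₂
  refine ⟨z + y, by rw [add_smul, add_assoc], fun w h1 h2 => ?_⟩
  by_cases h : min 0 z ≤ w ∧ w ≤ max 0 z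
  · exact hz w h.1 h.2
  · have := hy (w - z) (by omega) (by omega)
    rwa [add_assoc, ← add_smul, add_sub_cancel] at this

theorem line_eq_of_mem (h : q ∈ line P d p) : line P d q = line P d p :=
  Set.Subset.antisymm (fun _ hr => mem_line_trans h hr)
    (fun _ hr => mem_line_trans (mem_line_symm h) hr)

theorem line_neg : line P (-d) p = line P d p := by
  ext q
  constructor
  · rintro ⟨z, rfl, hz⟩
    refine ⟨-z, by simp, fun w h1 h2 => ?_⟩
    simpa using hz (-w) (by omega) (by omega)
  · rintro ⟨z, rfl, hz⟩
    refine ⟨-z, by simp, fun w h1 h2 => ?_⟩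
    simpa using hz (-w) (by omega) (by omega)

theorem ray_subset_line : ray P d p ⊆ line P d p := by
  rintro q ⟨j, rfl, hj⟩
  refine ⟨j, rfl, fun w h1 h2 => ?_⟩
  lift w to ℕ using by omega
  exact hj w (by omega)

theorem line_eq_union : line P d p = ray P d p ∪ ray P (-d) p := by
  apply Set.Subset.antisymm
  · rintro q ⟨z, rfl, hz⟩
    rcases le_total 0 z with h | h
    · lift z to ℕ using h
      exact Or.inl ⟨z, rfl, fun i hi => hz i (by omega) (by omega)⟩
    · obtain ⟨y, rfl⟩ := Int.exists_eq_neg_ofNat h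
      exact Or.inr ⟨y, by simp, fun i hi => by simpa using hz (-i) (by omega) (by omega)⟩
  · refine Set.union_subset ray_subset_line ?_
    rw [← line_neg]
    exact ray_subset_line

theorem add_mem_line (hp : p ∈ P) (hq : p + d ∈ P) : p + d ∈ line P d p := by
  refine ⟨1, by simp, fun w h1 h2 => ?_⟩
  obtain rfl | rfl : w = 0 ∨ w = 1 := by omega
  · simpa using hp
  · simpa using hq

theorem self_mem_ray (hp : p ∈ P) : p ∈ ray P d p :=
  ⟨0, by simp, fun i hi => by obtain rfl : i = 0 := by omega
                              simpa using hp⟩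

theorem ray_eq_singleton (hp : p ∈ P) (hq : p + d ∉ P) : ray P d p = {p} := by
  apply Set.Subset.antisymm
  · rintro q ⟨j, rfl, hj⟩
    rcases Nat.eq_zero_or_pos j with rfl | h
    · simp
    · exact absurd (by simpa using hj 1 h) hq
  · rintro q rfl
    exact self_mem_ray hp

theorem exists_run_length (hP : P.Finite) (hd : d ∈ unitSteps) (hp : p ∈ P) :
    ∃ n : ℕ, (∀ j : ℕ, j ≤ n → p + (j : ℤ) • d ∈ P) ∧ p + ((n : ℤ) + 1) • d ∉ P := by
  have hinj : Function.Injective (fun j : ℕ => p + (j : ℤ) • d) := by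
    intro i j h
    have h' := add_left_cancel h
    exact_mod_cast smul_left_injective ℤ (ne_zero_of_mem_unitSteps hd) h'
  have hex : ∃ n : ℕ, p + (n : ℤ) • d ∉ P := by
    by_contra! hall
    exact Set.infinite_of_injective_forall_mem hinj hall hP
  classical
  have hpos : Nat.find hex ≠ 0 := by
    intro h0
    have := Nat.find_spec hex
    rw [h0] at this
    simp [hp] at this
  obtain ⟨n, hn⟩ := Nat.exists_eq_succ_of_ne_zero hpos
  refine ⟨n, fun j hj => ?_, ?_⟩
  · exact not_not.1 (Nat.find_min hex (m := j) (by omega))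
  · have := Nat.find_spec hex
    rw [hn] at this
    exact_mod_cast this

theorem ray_eq {n : ℕ} (h₁ : ∀ j : ℕ, j ≤ n → p + (j : ℤ) • d ∈ P)
    (h₂ : p + ((n : ℤ) + 1) • d ∉ P) : ray P d p = {q | ∃ j : ℕ, j ≤ n ∧ q = p + (j : ℤ) • d} := by
  apply Set.Subset.antisymm
  · rintro q ⟨j, rfl, hj⟩
    refine ⟨j, ?_, rfl⟩
    by_contra! hlt
    exact h₂ (by exact_mod_cast hj (n + 1) hlt)
  · rintro q ⟨j, hj, rfl⟩
    exact ⟨j, rfl, fun i hi => h₁ i (hi.trans hj)⟩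

theorem line_subset_singleton (hp : p ∈ P) (h₁ : p + d ∉ P) (h₂ : p - d ∉ P) :
    line P d p = {p} := by
  rw [line_eq_union, ray_eq_singleton hp h₁, ray_eq_singleton hp (by rwa [← sub_eq_add_neg]),
    Set.union_self]

end Lines

namespace Walk

variable {P : Set Pixel} {d p : Pixel}

theorem along_ray (hP : P.Finite) (hd : d ∈ unitSteps) (hp : p ∈ P) (hq : p + d ∈ P)
    (a : Pixel) : Walk (p, a) (p, -d) (ray P d p) (bend a d + 2) := by
  obtain ⟨n, h1, h2⟩ := exists_run_length hP hd hp
  rw [ray_eq h1 h2]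
  cases n with
  | zero => simp [hq] at h2
  | succ n =>
    refine ((straight (p, a) hd n).trans (straight _ (neg_mem_unitSteps hd) n)).congr ?_ ?_
      (by simp [bend_neg hd])
    · ext <;> simp
    · ext q
      simp only [Set.mem_union, Set.mem_ofPred_eq]
      constructor
      · rintro (⟨j, hj, rfl⟩ | ⟨j, hj, rfl⟩)
        · exact ⟨j + 1, by omega, by push_cast; rfl⟩
        · refine ⟨n - j, by omega, ?_⟩
          rw [Nat.cast_sub hj]
          ext <;> simp <;> ring
      · rintro ⟨j, hj, rfl⟩
        rcases Nat.eq_zero_or_pos j with rfl | h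
        · right
          refine ⟨n, le_rfl, ?_⟩
          ext <;> simp
        · left
          refine ⟨j - 1, by omega, ?_⟩
          rw [Nat.cast_sub h]
          simp

theorem along_line_of_end (hP : P.Finite) (hd : d ∈ unitSteps) (hp : p ∈ P) (hq : p + d ∈ P)
    (hr : p - d ∉ P) (a : Pixel) : Walk (p, a) (p, -d) (line P d p) (bend a d + 2) := by
  refine (along_ray hP hd hp hq a).congr rfl ?_ rfl
  rw [line_eq_union, ray_eq_singleton (d := -d) hp (by rwa [← sub_eq_add_neg]), eq_comm,
    Set.union_eq_left, Set.singleton_subset_iff]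
  exact self_mem_ray hp

theorem along_line (hP : P.Finite) (hd : d ∈ unitSteps) (hp : p ∈ P) (hq : p + d ∈ P)
    (hr : p - d ∈ P) (a : Pixel) : Walk (p, a) (p, d) (line P d p) (bend a d + 4) := by
  refine ((along_ray hP hd hp hq a).trans
    (along_ray hP (neg_mem_unitSteps hd) hp (by rwa [← sub_eq_add_neg]) _)).congr
    (by rw [neg_neg]) line_eq_union.symm (by simp [bend_self])

/-- A closed walk along a line with at least two pixels. -/
theorem exists_closed_line (hP : P.Finite) (hd : d ∈ unitSteps) (hp : p ∈ P)
    (hq : p + d ∈ P ∨ p - d ∈ P) : ∃ s, Walk s s (line P d p) 4 := by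
  by_cases h1 : p + d ∈ P <;> by_cases h2 : p - d ∈ P
  · exact ⟨_, (along_line hP hd hp h1 h2 d).congr rfl rfl (by simp [bend_self])⟩
  · exact ⟨_, (along_line_of_end hP hd hp h1 h2 (-d)).congr rfl rfl (by rw [bend_neg' hd])⟩
  · rw [← line_neg]
    rw [sub_eq_add_neg] at h2
    exact ⟨_, (along_line_of_end hP (neg_mem_unitSteps hd) hp h2 (by simpa using h1) (- -d)).congr
      rfl rfl (by rw [bend_neg' (neg_mem_unitSteps hd)])⟩
  · exact absurd hq (by simp [h1, h2])

variable {A : Set Pixel} {n : ℕ}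

/-- Splicing a line into a closed walk meeting it. -/
theorem splice_line {s : Pixel × Pixel} (hP : P.Finite) (hs : Walk s s A n) (hd : d ∈ unitSteps)
    (hpA : p ∈ A) (hp : p ∈ P) (hq : p + d ∈ P ∨ p - d ∈ P) :
    ∃ s, ∃ m ≤ n + 6, Walk s s (A ∪ line P d p) m := by
  obtain ⟨a, h⟩ := hs.rotate hpA
  obtain ⟨b, hb, -, m, rfl, hr⟩ := h.redirect
  dsimp only at hr ⊢
  have ha := h.step_mem
  have one_sided : ∀ e ∈ unitSteps, p + e ∈ P → p - e ∉ P → line P e p = line P d p →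
      ∃ s, ∃ m' ≤ bend a b + m + 6, Walk s s (A ∪ line P d p) m' := by
    intro e he h1 h2 hl
    refine ⟨_, _, ?_, ((along_line_of_end hP he hp h1 h2 a).trans (hr _)).congr rfl
      (by rw [Set.union_comm, hl]) rfl⟩
    have := bend_le_two a e
    have := bend_le_two (-e) b
    omega
  by_cases h1 : p + d ∈ P <;> by_cases h2 : p - d ∈ P
  · rcases exists_bend_add_bend_le a ha b hb d hd with hle | hle
    · exact ⟨_, _, by omega, ((along_line hP hd hp h1 h2 a).trans (hr _)).congr rfl
        (Set.union_comm _ _) rfl⟩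
    · refine ⟨_, _, by omega, ((along_line hP (neg_mem_unitSteps hd) hp
        (by rwa [← sub_eq_add_neg]) (by simpa using h1) a).trans (hr _)).congr rfl
        (by rw [Set.union_comm, line_neg]) rfl⟩
  · exact one_sided d hd h1 h2 rfl
  · exact one_sided (-d) (neg_mem_unitSteps hd) (by rwa [← sub_eq_add_neg]) (by simpa using h1)
      line_neg
  · exact absurd hq (by simp [h1, h2])

/-- A side trip from `p` to the adjacent pixel `p + h` and back. -/
theorem detour {t : Pixel × Pixel} {L : Set Pixel} {h e : Pixel} {k : ℕ} (hh : h ∈ unitSteps)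
    (hA : Walk (p, -h) t A n) (hL : Walk (p + h, h) (p + h, e) L k) (heh : e ≠ h) (heh' : e ≠ -h)
    (hpA : p ∈ A) (a : Pixel) : Walk (p, a) t (A ∪ L) (bend a h + k + 1 + n) := by
  have hback : Walk (p + h, e) (p, -h) {p} 1 :=
    (single (p + h, e) (-h) (neg_mem_unitSteps hh)).congr (by simp) (by simp)
      (bend_perp heh'.symm (fun h' => heh (neg_injective h').symm))
  refine ((((single (p, a) h hh).trans hL).trans hback).trans hA).congr rfl ?_ rfl
  rw [Set.union_eq_right.2 (Set.singleton_subset_iff.2 hL.final_mem), Set.union_assoc,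
    Set.union_eq_right.2 (Set.singleton_subset_iff.2 hpA), Set.union_comm]

/-- Splicing into a closed walk through `p` a line having an endpoint adjacent to `p`. -/
theorem splice_adjacent_end {s : Pixel × Pixel} {h : Pixel} (hP : P.Finite) (hs : Walk s s A n)
    (hd : d ∈ unitSteps) (hh : h ∈ unitSteps) (hdh : d ≠ h) (hdh' : d ≠ -h) (hpA : p ∈ A)
    (hp : p + h ∈ P) (hq : p + h + d ∈ P) (hr : p + h - d ∉ P) :
    ∃ s, ∃ m ≤ n + 6, Walk s s (A ∪ line P d (p + h)) m := by
  obtain ⟨a, hw⟩ := hs.rotate hpA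
  obtain ⟨b, hb, -, m, rfl, hr'⟩ := hw.redirect
  dsimp only at hr' ⊢
  have hc := bend_add_bend_neg_le a hw.step_mem b hb h hh
  have hp' := bend_perp hdh hdh'
  refine ⟨_, _, ?_, detour hh (hr' (-h)) (along_line_of_end hP hd hp hq hr h)
    (fun h' => hdh' (by rw [← h', neg_neg])) (fun h' => hdh (neg_injective h')) hpA a⟩
  omega

/-- Splicing into a closed walk a line parallel to the line it follows near `p`, where the latter
ends. -/
theorem splice_adjacent_interior {s : Pixel × Pixel} {h : Pixel} (hP : P.Finite)
    (hs : Walk s s A n) (hAP : A ⊆ P) (hd : d ∈ unitSteps) (hh : h ∈ unitSteps) (hdh : d ≠ h)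
    (hdh' : d ≠ -h) (hpA : p ∈ A) (hpd : p + d ∉ P) (hpA' : p + h ∉ A) (hp : p + h ∈ P)
    (hq : p + h + d ∈ P) (hr : p + h - d ∈ P) :
    ∃ s, ∃ m ≤ n + 6, Walk s s (A ∪ line P d (p + h)) m := by
  obtain ⟨a, hw⟩ := hs.rotate hpA
  obtain ⟨b, hb, hpb, m, rfl, hr'⟩ := hw.redirect
  have hpa := hw.sub_step_of_closed
  dsimp only at hr' hpb hpa ⊢
  have hc := bend_add_bend_neg_le_of_ne a hw.step_mem b hb h hh d hd hdh hdh'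
    (by rintro rfl; exact hpA' (by simpa using hpa)) (by rintro rfl; exact hpA' hpb)
    (by rintro rfl; exact hpd (hAP (by simpa using hpa))) (by rintro rfl; exact hpd (hAP hpb))
  have hp' := bend_perp hdh hdh'
  refine ⟨_, _, ?_, detour hh (hr' (-h)) (along_line hP hd hp hq hr h) hdh hdh' hpA a⟩
  omega

/-- Splicing into a closed walk containing the line through `p` the parallel line through `p + h`. -/
theorem splice_parallel {s : Pixel × Pixel} {h : Pixel} (hP : P.Finite) (hs : Walk s s A n)
    (hAP : A ⊆ P) (hd : d ∈ unitSteps) (hh : h ∈ unitSteps) (hdh : d ≠ h) (hdh' : d ≠ -h)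
    (hpA : line P d p ⊆ A) (hp : p ∈ P) (hph : p + h ∈ P)
    (hq : p + h + d ∈ P ∨ p + h - d ∈ P) :
    ∃ s, ∃ m ≤ n + 6, Walk s s (A ∪ line P d (p + h)) m := by
  obtain ⟨k, hk, hk'⟩ := exists_run_length hP hd hp
  obtain ⟨l, hl, hl'⟩ := exists_run_length hP hd hph
  have key : ∀ j : ℕ, j ≤ k → j ≤ l → (j = k ∨ j = l) →
      ∃ s, ∃ m ≤ n + 6, Walk s s (A ∪ line P d (p + h)) m := by
    intro j hjk hjl hj
    set p' := p + (j : ℤ) • d with hp'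
    have hmem : p' + h ∈ ray P d (p + h) :=
      ⟨j, by rw [hp', add_right_comm], fun i hi => hl i (hi.trans hjl)⟩
    have hline := line_eq_of_mem (ray_subset_line hmem)
    have hpA' : p' ∈ A := hpA (ray_subset_line ⟨j, rfl, fun i hi => hk i (hi.trans hjk)⟩)
    have hph' : p' + h ∈ P := line_subset (ray_subset_line hmem)
    have hq' : p' + h + d ∈ P ∨ p' + h - d ∈ P := by
      by_contra! hcon
      have hs := line_subset_singleton hph' hcon.1 hcon.2
      rw [hline] at hs
      have h0 : p + h = p' + h := by
        have := self_mem_line (d := d) hph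
        rwa [hs] at this
      rw [← h0] at hcon
      tauto
    rw [← hline]
    by_cases hA : p' + h ∈ A
    · exact splice_line hP hs hd hA hph' hq'
    by_cases h1 : p' + h + d ∈ P <;> by_cases h2 : p' + h - d ∈ P
    · refine splice_adjacent_interior hP hs hAP hd hh hdh hdh' hpA' ?_ hA hph' h1 h2
      rcases hj with rfl | rfl
      · rwa [hp', add_assoc, ← add_one_zsmul]
      · refine absurd h1 ?_
        rwa [hp', add_right_comm p, add_assoc, ← add_one_zsmul]
    · exact splice_adjacent_end hP hs hd hh hdh hdh' hpA' hph' h1 h2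
    · rw [← line_neg]
      exact splice_adjacent_end hP hs (neg_mem_unitSteps hd) hh
        (fun h' => hdh' (by rw [← h', neg_neg])) (fun h' => hdh (neg_injective h')) hpA' hph'
        (by rwa [← sub_eq_add_neg]) (by simpa using h1)
    · tauto
  rcases le_total k l with hkl | hkl
  · exact key k le_rfl hkl (Or.inl rfl)
  · exact key l hkl le_rfl (Or.inr rfl)

end Walk

/-- The unit steps along the two coordinate axes. -/
def axes : Finset Pixel := {(1, 0), (0, 1)}

theorem axes_subset : axes ⊆ unitSteps := by decide

theorem exists_axis : ∀ h ∈ unitSteps, ∃ d ∈ axes, h = d ∨ h = -d := by decide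

section Strips

variable {P : Set Pixel} {p q : Pixel}

theorem exists_axis_of_isStrip {S : Set Pixel} (hS : IsStrip P S) (hp : p ∈ S) (hq : q ∈ S) :
    ∃ d ∈ axes, p ∈ line P d q := by
  rcases hS with ⟨x, y, l, rfl, hSP, -, -⟩ | ⟨x, y, l, rfl, hSP, -, -⟩
  · obtain ⟨p1, p2⟩ := p
    obtain ⟨q1, q2⟩ := q
    obtain ⟨h1, h2, h3⟩ := hp
    obtain ⟨h4, h5, h6⟩ := hq
    dsimp only at *
    refine ⟨(1, 0), by simp [axes], p1 - q1, by ext <;> simp; omega, fun w h7 h8 => hSP ?_⟩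
    refine ⟨?_, ?_, ?_⟩ <;> simp <;> omega
  · obtain ⟨p1, p2⟩ := p
    obtain ⟨q1, q2⟩ := q
    obtain ⟨h1, h2, h3⟩ := hp
    obtain ⟨h4, h5, h6⟩ := hq
    dsimp only at *
    refine ⟨(0, 1), by simp [axes], p2 - q2, by ext <;> simp; omega, fun w h7 h8 => hSP ?_⟩
    refine ⟨?_, ?_, ?_⟩ <;> simp <;> omega

theorem exists_int_interval {P : Set Pixel} {p d : Pixel} (hP : P.Finite) (hd : d ∈ unitSteps)
    (hp : p ∈ P) : ∃ m n : ℕ, (∀ j : ℤ, -m ≤ j → j ≤ n → p + j • d ∈ P) ∧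
      p + (-(m : ℤ) - 1) • d ∉ P ∧ p + ((n : ℤ) + 1) • d ∉ P := by
  obtain ⟨n, h1, h2⟩ := exists_run_length hP hd hp
  obtain ⟨m, h3, h4⟩ := exists_run_length hP (neg_mem_unitSteps hd) hp
  refine ⟨m, n, fun j hj hj' => ?_, ?_, h2⟩
  · rcases le_total 0 j with h | h
    · lift j to ℕ using h
      exact h1 j (by omega)
    · obtain ⟨i, rfl⟩ := Int.exists_eq_neg_ofNat h
      simpa using h3 i (by omega)
  · rwa [smul_neg, ← neg_smul, neg_add'] at h4

theorem exists_isStrip_of_mem_line {d : Pixel} (hP : P.Finite) (hd : d ∈ unitSteps) (hp : p ∈ P)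
    (hq : q ∈ line P d p) : ∃ S, IsStrip P S ∧ p ∈ S ∧ q ∈ S := by
  obtain ⟨e, he, hde⟩ := exists_axis d hd
  have hq' : q ∈ line P e p := by
    rcases hde with rfl | rfl
    · exact hq
    · rwa [line_neg] at hq
  obtain ⟨m, n, h1, h2, h3⟩ := exists_int_interval hP (axes_subset he) hp
  obtain ⟨z, rfl, hz⟩ := hq'
  have hz1 : -(m : ℤ) ≤ z := by
    by_contra! hlt
    exact h2 (hz _ (by omega) (by omega))
  have hz2 : z ≤ n := by
    by_contra! hlt
    exact h3 (hz _ (by omega) (by omega))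
  obtain ⟨a, b⟩ := p
  simp only [axes, Finset.mem_insert, Finset.mem_singleton] at he
  rcases he with rfl | rfl
  · refine ⟨_, Or.inl ⟨a - m, b, m + n, rfl, ?_, ?_, ?_⟩, ?_, ?_⟩
    · rintro ⟨c, e⟩ ⟨h4, h5, h6⟩
      dsimp only at *
      push_cast at h6
      have := h1 (c - a) (by omega) (by omega)
      simpa [h4] using this
    · convert h2 using 2; ext <;> simp
      ring
    · convert h3 using 2; ext <;> simp
      ring
    · refine ⟨rfl, ?_, ?_⟩ <;> simp
      omega
    · refine ⟨?_, ?_, ?_⟩ <;> simp <;> omega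
  · refine ⟨_, Or.inr ⟨a, b - m, m + n, rfl, ?_, ?_, ?_⟩, ?_, ?_⟩
    · rintro ⟨c, e⟩ ⟨h4, h5, h6⟩
      dsimp only at *
      push_cast at h6
      have := h1 (e - b) (by omega) (by omega)
      simpa [h4] using this
    · convert h2 using 2; ext <;> simp
      ring
    · convert h3 using 2; ext <;> simp
      ring
    · refine ⟨rfl, ?_, ?_⟩ <;> simp
      omega
    · refine ⟨?_, ?_, ?_⟩ <;> simp <;> omega

end Strips

namespace GridCycle

variable (C : GridCycle)

theorem step_mem_unitSteps (i : ℤ) : C.pts i - C.pts (i - 1) ∈ unitSteps := by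
  have := sub_mem_unitSteps (C.adj (i - 1))
  rwa [sub_add_cancel] at this

theorem pts_add_mul (i m : ℤ) : C.pts (i + m * C.k) = C.pts i := by
  induction m using Int.induction_on with
  | zero => simp
  | succ n ih => rw [add_one_mul, ← add_assoc, C.periodic, ih]
  | pred n ih =>
    rw [← C.periodic, ← ih]
    congr 1
    ring

theorem pts_eq_of_modEq {i j : ℤ} (h : i ≡ j [ZMOD C.k]) : C.pts i = C.pts j := by
  obtain ⟨m, hm⟩ := h.dvd
  rw [← C.pts_add_mul i m]
  congr 1
  linarith

theorem turnCost_eq_of_modEq {i j : ℤ} (h : i ≡ j [ZMOD C.k]) : C.turnCost i = C.turnCost j := by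
  rw [turnCost, turnCost, C.pts_eq_of_modEq h, C.pts_eq_of_modEq (h.add_right 1),
    C.pts_eq_of_modEq (h.sub_right 1)]

theorem sub_eq_of_turnCost_eq_zero {i : ℤ} (h : C.turnCost i = 0) :
    C.pts (i + 1) - C.pts i = C.pts i - C.pts (i - 1) := by
  unfold turnCost at h
  split_ifs at h
  assumption

theorem pts_add_of_straight {i : ℤ} {n : ℕ} (h : ∀ m : ℕ, m < n → C.turnCost (i + m) = 0) :
    ∀ m : ℕ, m ≤ n → C.pts (i + m) = C.pts i + (m : ℤ) • (C.pts i - C.pts (i - 1)) ∧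
      C.pts (i + m) - C.pts (i + m - 1) = C.pts i - C.pts (i - 1) := by
  intro m hm
  induction m with
  | zero => simp
  | succ m ih =>
    obtain ⟨h1, h2⟩ := ih (by omega)
    have h3 := C.sub_eq_of_turnCost_eq_zero (h m hm)
    rw [h2] at h3
    have h4 : i + ((m + 1 : ℕ) : ℤ) = i + m + 1 := by push_cast; ring
    rw [h4, add_sub_cancel_right]
    refine ⟨?_, h3⟩
    rw [← sub_add_cancel (C.pts (i + m + 1)) (C.pts (i + m)), h3, h1]
    push_cast
    module

theorem exists_turn_after (i : ℤ) : ∃ n : ℕ, C.turnCost (i + n) ≠ 0 := by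
  by_contra! h
  have h1 := (C.pts_add_of_straight (i := i) (n := C.k) (fun m _ => h m) C.k le_rfl).1
  rw [C.periodic, left_eq_add, smul_eq_zero] at h1
  rcases h1 with h1 | h1
  · have := C.two_le
    omega
  · exact ne_zero_of_mem_unitSteps (C.step_mem_unitSteps i) h1

theorem mem_line_of_straight {P : Set Pixel} (hC : C.covers ⊆ P) {i : ℤ} {n : ℕ}
    (h : ∀ m : ℕ, m < n → C.turnCost (i + m) = 0) :
    C.pts (i + n) ∈ line P (C.pts i - C.pts (i - 1)) (C.pts i) := by
  have hs := C.pts_add_of_straight h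
  refine ⟨n, (hs n le_rfl).1, fun w h1 h2 => ?_⟩
  lift w to ℕ using by omega
  rw [← (hs w (by omega)).1]
  exact hC ⟨_, rfl⟩

theorem ncard_le_turns {P R : Set Pixel} (hP : P.Finite) (hR : IsRookPlacement P R)
    (hC : C.covers = P) : R.ncard ≤ C.turns := by
  classical
  have hpos : ∀ r ∈ R, ∃ i, C.pts i = r := fun r hr => by
    have := hR.1 hr
    rwa [← hC] at this
  choose! pos hpos using hpos
  let next : Pixel → ℕ := fun r => Nat.find (C.exists_turn_after (pos r))
  have hnext : ∀ r, C.turnCost (pos r + next r) ≠ 0 :=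
    fun r => Nat.find_spec (C.exists_turn_after (pos r))
  have hmin : ∀ r, ∀ m < next r, C.turnCost (pos r + m) = 0 :=
    fun r m hm => not_not.1 (Nat.find_min (C.exists_turn_after (pos r)) hm)
  have hk : (0 : ℤ) < C.k := by
    have := C.two_le
    omega
  have same : ∀ r ∈ R, ∀ s ∈ R, next r ≤ next s →
      (pos r + next r) ≡ (pos s + next s) [ZMOD C.k] → s = r := by
    intro r hr s hs hle hmod
    by_contra hne
    refine hR.2 s hs r hr hne ?_
    have h1 : pos s + (next s - next r : ℕ) ≡ pos r [ZMOD C.k] := by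
      rw [Nat.cast_sub hle]
      have := (hmod.sub_right (next r : ℤ)).symm
      rwa [add_sub_cancel_right, add_sub_assoc] at this
    have h2 := C.mem_line_of_straight hC.le (i := pos s) (n := next s - next r)
      (fun m hm => hmin s m (by omega))
    rw [C.pts_eq_of_modEq h1, hpos r hr] at h2
    have h3 := exists_isStrip_of_mem_line hP (C.step_mem_unitSteps (pos s))
      (by rw [hpos s hs]; exact hR.1 hs) h2
    rwa [hpos s hs] at h3
  let T := (Finset.range C.k).filter (fun i : ℕ => C.turnCost i ≠ 0)
  have hcast : ∀ z : ℤ, (((z % C.k).toNat : ℕ) : ℤ) = z % C.k :=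
    fun z => Int.toNat_of_nonneg (Int.emod_nonneg z hk.ne')
  have hcard : R.ncard ≤ (T : Set ℕ).ncard := by
    refine Set.ncard_le_ncard_of_injOn (fun r => ((pos r + next r) % C.k).toNat) ?_ ?_
      T.finite_toSet
    · intro r hr
      simp only [T, Finset.coe_filter, Finset.mem_range, Set.mem_ofPred_eq]
      constructor
      · have := Int.emod_lt_of_pos (pos r + next r) hk
        have := hcast (pos r + next r)
        omega
      · rw [hcast, C.turnCost_eq_of_modEq (Int.mod_modEq _ _)]
        exact hnext r
    · intro r hr s hs h
      have h' : (pos r + next r) ≡ (pos s + next s) [ZMOD C.k] := by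
        change _ % _ = _ % _
        rw [← hcast, ← hcast (pos s + _)]
        exact congrArg _ h
      rcases le_total (next r) (next s) with hle | hle
      · exact (same r hr s hs hle h').symm
      · exact same s hs r hr hle h'.symm
  rw [Set.ncard_coe_finset] at hcard
  calc R.ncard ≤ T.card := hcard
    _ = ∑ i ∈ T, 1 := by simp
    _ ≤ ∑ i ∈ T, C.turnCost i := Finset.sum_le_sum fun i hi => by
        have := (Finset.mem_filter.1 hi).2
        omega
    _ ≤ C.turns := Finset.sum_le_sum_of_subset (Finset.filter_subset _ _)

end GridCycle

section Regions

variable {P R A : Set Pixel} {p : Pixel}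

theorem IsRegion.exists_neighbor (hP : IsRegion P) (h2 : 2 ≤ P.ncard) (hp : p ∈ P) :
    ∃ h ∈ unitSteps, p + h ∈ P := by
  obtain ⟨q, hq, hqp⟩ := Set.exists_ne_of_one_lt_ncard h2 p
  rcases (hP.2.2 p hp q hq).cases_head with rfl | ⟨c, ⟨hc, hadj⟩, -⟩
  · exact absurd rfl hqp
  · exact ⟨c - p, sub_mem_unitSteps hadj, by rwa [add_sub_cancel]⟩

theorem ConnectedIn.exists_boundary (hP : ConnectedIn P) (hAP : A ⊆ P) (hA : A.Nonempty)
    (hne : A ≠ P) : ∃ p ∈ A, ∃ h ∈ unitSteps, p + h ∈ P ∧ p + h ∉ A := by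
  by_contra! hcon
  obtain ⟨a, ha⟩ := hA
  refine hne (hAP.antisymm fun q hq => ?_)
  have := hP a (hAP ha) q hq
  clear hq
  induction this with
  | refl => exact ha
  | @tail b c _ hbc ih =>
    have := hcon b ih (c - b) (sub_mem_unitSteps hbc.2)
    rw [add_sub_cancel] at this
    exact this hbc.1

theorem IsMaximalRookPlacement.exists_line (hR : IsMaximalRookPlacement P R) (hp : p ∈ P) :
    ∃ r ∈ R, ∃ d ∈ axes, p ∈ line P d r := by
  obtain ⟨r, hr, S, hS, hpS, hrS⟩ := hR.2 p hp
  obtain ⟨d, hd, h⟩ := exists_axis_of_isStrip hS hpS hrS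
  exact ⟨r, hr, d, hd, h⟩

theorem IsMaximalRookPlacement.exists_nontrivial_line (hR : IsMaximalRookPlacement P R)
    (hP : IsRegion P) (h2 : 2 ≤ P.ncard) (hp : p ∈ P) :
    ∃ r ∈ R, ∃ d ∈ axes, p ∈ line P d r ∧ (p + d ∈ P ∨ p - d ∈ P) := by
  obtain ⟨r, hr, d, hd, hpr⟩ := hR.exists_line hp
  by_cases hnt : p + d ∈ P ∨ p - d ∈ P
  · exact ⟨r, hr, d, hd, hpr, hnt⟩
  rw [not_or] at hnt
  obtain rfl : r = p := by
    have := mem_line_symm hpr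
    rwa [line_subset_singleton hp hnt.1 hnt.2] at this
  obtain ⟨h, hh, hph⟩ := hP.exists_neighbor h2 hp
  obtain ⟨e, he, rfl | rfl⟩ := exists_axis h hh
  · exact ⟨r, hr, h, he, self_mem_line hp, Or.inl hph⟩
  · exact ⟨r, hr, e, he, self_mem_line hp, Or.inr (by rwa [sub_eq_add_neg])⟩

theorem Walk.exists_splice {s : Pixel × Pixel} {n : ℕ} {e h : Pixel} (hP : P.Finite)
    (hR : IsMaximalRookPlacement P R) (hs : Walk s s A n) (hAP : A ⊆ P) (hpA : p ∈ A)
    (he : e ∈ unitSteps) (heA : line P e p ⊆ A) (hh : h ∈ unitSteps) (hph : p + h ∈ P)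
    (hphA : p + h ∉ A) : ∃ r ∈ R, ∃ d ∈ axes, p + h ∈ line P d r ∧
      ∃ s, ∃ m ≤ n + 6, Walk s s (A ∪ line P d r) m := by
  have hp := hAP hpA
  have across : ∀ r ∈ R, ∀ d ∈ axes, p + h ∈ line P d r → (h = d ∨ h = -d) →
      ∃ r ∈ R, ∃ d ∈ axes, p + h ∈ line P d r ∧
        ∃ s, ∃ m ≤ n + 6, Walk s s (A ∪ line P d r) m := by
    intro r hr d hd hq hhd
    refine ⟨r, hr, d, hd, hq, ?_⟩
    have hmem : p + h ∈ line P d p := by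
      rcases hhd with rfl | rfl
      · exact add_mem_line hp hph
      · rw [← line_neg]
        exact add_mem_line hp hph
    rw [← line_eq_of_mem hq, line_eq_of_mem hmem]
    refine splice_line hP hs (axes_subset hd) hpA hp ?_
    rcases hhd with rfl | rfl
    · exact Or.inl hph
    · exact Or.inr (by rwa [sub_eq_add_neg])
  obtain ⟨r, hr, d, hd, hq⟩ := hR.exists_line hph
  by_cases hhd : h = d ∨ h = -d
  · exact across r hr d hd hq hhd
  rw [not_or] at hhd
  by_cases hnt : p + h + d ∈ P ∨ p + h - d ∈ P
  · refine ⟨r, hr, d, hd, hq, ?_⟩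
    have hed : line P d p ⊆ A := by
      rcases eq_or_eq_neg_of_perp d (axes_subset hd) e he h hh hhd.1 hhd.2
        (by rintro rfl; exact hphA (heA (add_mem_line hp hph)))
        (by rintro rfl; exact hphA (heA (by rw [← line_neg]; exact add_mem_line hp hph)))
        with rfl | rfl
      · exact heA
      · rwa [line_neg] at heA
    rw [← line_eq_of_mem hq]
    exact splice_parallel hP hs hAP (axes_subset hd) hh (Ne.symm hhd.1)
      (fun h' => hhd.2 (by rw [h', neg_neg])) hed hp hph hnt
  · rw [not_or] at hnt
    have hrq : r = p + h := by
      have := mem_line_symm hq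
      rwa [line_subset_singleton hph hnt.1 hnt.2] at this
    obtain ⟨d', hd', hhd'⟩ := exists_axis h hh
    exact across r hr d' hd' (by rw [hrq]; exact self_mem_line hph) hhd'

theorem exists_closed_walk (hP : IsRegion P) (h2 : 2 ≤ P.ncard)
    (hR : IsMaximalRookPlacement P R) {F : Finset (Pixel × Pixel)}
    (hF : ∀ i, i ∈ F ↔ i.1 ∈ R ∧ i.2 ∈ axes) :
    ∃ s n, n + 2 ≤ 6 * F.card ∧ Walk s s P n := by
  classical
  have grow : ∀ k : ℕ, ∀ G ⊆ F, (F \ G).card = k →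
      (∃ s n, n + 2 ≤ 6 * G.card ∧ Walk s s (⋃ i ∈ G, line P i.2 i.1) n) →
      ∃ s n, n + 2 ≤ 6 * F.card ∧ Walk s s P n := by
    intro k
    induction k with
    | zero =>
      rintro G hG hk ⟨s, n, hn, hs⟩
      obtain rfl : G = F :=
        hG.antisymm (Finset.sdiff_eq_empty_iff_subset.1 (Finset.card_eq_zero.1 hk))
      refine ⟨s, n, hn, hs.congr rfl ?_ rfl⟩
      refine Set.Subset.antisymm (Set.iUnion₂_subset fun i _ => line_subset) fun p hp => ?_
      obtain ⟨r, hr, d, hd, hpr⟩ := hR.exists_line hp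
      exact Set.mem_biUnion (x := (r, d)) ((hF _).2 ⟨hr, hd⟩) hpr
    | succ k ih =>
      rintro G hG hk ⟨s, n, hn, hs⟩
      set A := ⋃ i ∈ G, line P i.2 i.1 with hA
      have hAP : A ⊆ P := Set.iUnion₂_subset fun i _ => line_subset
      by_cases hne : A = P
      · have := Finset.card_le_card hG
        exact ⟨s, n, by omega, hne ▸ hs⟩
      obtain ⟨p, hpA, h, hh, hph, hphA⟩ := hP.2.2.exists_boundary hAP ⟨_, hs.final_mem⟩ hne
      obtain ⟨i, hi, hpi⟩ := Set.mem_iUnion₂.1 hpA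
      obtain ⟨r, hr, d, hd, hq, s', m, hm, hs'⟩ := hs.exists_splice hP.1 hR hAP hpA
        (axes_subset ((hF i).1 (hG hi)).2)
        (by
          rw [line_eq_of_mem hpi]
          exact Set.subset_biUnion_of_mem (u := fun i => line P i.2 i.1) hi)
        hh hph hphA
      have hrG : (r, d) ∉ G := fun h' => hphA (Set.mem_biUnion (x := (r, d)) h' hq)
      have hrF : (r, d) ∈ F := (hF _).2 ⟨hr, hd⟩
      refine ih (insert (r, d) G) (Finset.insert_subset hrF hG) ?_ ⟨s', m, ?_, ?_⟩
      · rw [Finset.sdiff_insert, Finset.card_erase_of_mem (Finset.mem_sdiff.2 ⟨hrF, hrG⟩), hk,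
          Nat.add_sub_cancel]
      · rw [Finset.card_insert_of_notMem hrG]
        omega
      · rwa [Finset.set_biUnion_insert, Set.union_comm]
  obtain ⟨p, hp⟩ := hP.2.1
  obtain ⟨r, hr, d, hd, hpr, hnt⟩ := hR.exists_nontrivial_line hP h2 hp
  obtain ⟨s, hs⟩ := Walk.exists_closed_line hP.1 (axes_subset hd) hp hnt
  refine grow _ {(r, d)} (Finset.singleton_subset_iff.2 ((hF _).2 ⟨hr, hd⟩)) rfl ⟨s, 4, ?_, ?_⟩
  · simp
  · rw [Finset.set_biUnion_singleton, ← line_eq_of_mem hpr]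
    exact hs

theorem exists_cycleCover (hP : IsRegion P) (h2 : 2 ≤ P.ncard)
    (hR : IsMaximalRookPlacement P R) {F : Finset (Pixel × Pixel)}
    (hF : ∀ i, i ∈ F ↔ i.1 ∈ R ∧ i.2 ∈ axes) :
    ∃ CC : List GridCycle, IsCycleCover P CC ∧ coverTurns CC ≤ 4 * F.card := by
  classical
  have key : ∀ G ⊆ F, ∃ CC : List GridCycle, (∀ C ∈ CC, C.covers ⊆ P) ∧
      (∀ p, ∀ i ∈ G, p ∈ line P i.2 i.1 → (p + i.2 ∈ P ∨ p - i.2 ∈ P) → ∃ C ∈ CC, p ∈ C.covers) ∧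
      coverTurns CC ≤ 4 * G.card := by
    intro G
    induction G using Finset.induction_on with
    | empty => exact fun _ => ⟨[], by simp, by simp, by simp [coverTurns]⟩
    | insert i G hi ih =>
      intro hG
      obtain ⟨CC, h1, h2, h3⟩ := ih ((Finset.subset_insert _ _).trans hG)
      have hd := axes_subset ((hF i).1 (hG (Finset.mem_insert_self _ _))).2
      rw [Finset.card_insert_of_notMem hi]
      by_cases hex : ∃ p ∈ line P i.2 i.1, p + i.2 ∈ P ∨ p - i.2 ∈ P
      · obtain ⟨p, hp, hnt⟩ := hex
        obtain ⟨s, hs⟩ := Walk.exists_closed_line hP.1 hd (line_subset hp) hnt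
        obtain ⟨C, hC, hC'⟩ := hs.exists_gridCycle
        rw [line_eq_of_mem hp] at hC
        refine ⟨C :: CC, ?_, ?_, ?_⟩
        · rw [List.forall_mem_cons]
          exact ⟨hC ▸ line_subset, h1⟩
        · intro q j hj hq hq'
          rcases Finset.mem_insert.1 hj with rfl | hj
          · exact ⟨C, List.mem_cons_self, hC ▸ hq⟩
          · obtain ⟨D, hD, hqD⟩ := h2 q j hj hq hq'
            exact ⟨D, List.mem_cons_of_mem _ hD, hqD⟩
        · simp only [coverTurns, List.map_cons, List.sum_cons] at h3 ⊢
          omega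
      · refine ⟨CC, h1, fun q j hj hq hq' => ?_, by omega⟩
        rcases Finset.mem_insert.1 hj with rfl | hj
        · exact absurd ⟨q, hq, hq'⟩ hex
        · exact h2 q j hj hq hq'
  obtain ⟨CC, h1, h3, h4⟩ := key F subset_rfl
  refine ⟨CC, ⟨h1, fun p hp => ?_⟩, h4⟩
  obtain ⟨r, hr, d, hd, hpr, hnt⟩ := hR.exists_nontrivial_line hP h2 hp
  exact h3 p (r, d) ((hF _).2 ⟨hr, hd⟩) hpr hnt

end Regions

/-- 12-approximation from a maximal rook placement: for a region `P` with at
least two pixels and a maximal rook placement `R`, `P` admits a cycle cover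
with at most `10·|R|` turns and a tour with at most `12·|R| − 2` turns; every
tour of `P` has at least `|R|` turns, so the latter tour has at most 12 times
the minimum number of turns of a tour of `P`. -/
theorem twelve_approx_tour (P : Set Pixel) (hP : IsRegion P) (h2 : 2 ≤ P.ncard)
    (R : Set Pixel) (hR : IsMaximalRookPlacement P R) :
    (∃ CC : List GridCycle, IsCycleCover P CC ∧ coverTurns CC ≤ 10 * R.ncard) ∧
    (∀ C' : GridCycle, IsTour P C' → R.ncard ≤ C'.turns) ∧
    ∃ C : GridCycle, IsTour P C ∧ C.turns ≤ 12 * R.ncard - 2 ∧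
      ∀ C' : GridCycle, IsTour P C' → C.turns ≤ 12 * C'.turns := by
  have hRfin : R.Finite := hP.1.subset hR.1.1
  have hF : ∀ i, i ∈ hRfin.toFinset ×ˢ axes ↔ i.1 ∈ R ∧ i.2 ∈ axes := fun i => by simp
  have hcard : (hRfin.toFinset ×ˢ axes).card = R.ncard * 2 := by
    rw [Finset.card_product, Set.ncard_eq_toFinset_card R hRfin]
    rfl
  have hlower : ∀ C' : GridCycle, IsTour P C' → R.ncard ≤ C'.turns :=
    fun C' hC' => C'.ncard_le_turns hP.1 hR.1 hC'
  refine ⟨?_, hlower, ?_⟩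
  · obtain ⟨CC, h, hle⟩ := exists_cycleCover hP h2 hR hF
    exact ⟨CC, h, by omega⟩
  · obtain ⟨s, n, hn, hs⟩ := exists_closed_walk hP h2 hR hF
    obtain ⟨C, hC, rfl⟩ := hs.exists_gridCycle
    refine ⟨C, hC, by omega, fun C' hC' => ?_⟩
    have := hlower C' hC'
    omega
end
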